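/- arXiv:math/0312104 — 5 statements merged into one kernel-verified Lean document; each statement's English description precedes it below -/
import Mathlib

section
/- Let a : [0,∞) → ℂ be measurable with sup_{t>0} |a(t)| = M < ∞, and suppose its Laplace transform f(z) = ∫₀^∞ a(t)e^{-zt} dt (analytic for Re z > 0) has an analytic extension to a neighborhood of the segment [-iR, iR], R > 0. Then for every T > 0: |∫₀^T a(t) dt - f(0)| ≤ 2M/R + |f(0)|/(eRT) + (1/2π) |∫_{-R}^{R} (f(iy) - f(0)) (1/(iy) + iy/R²) e^{iTy} dy|. -/
open MeasureTheory Complex Set Real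

lemma intgA (a : ℝ → ℂ) (M : ℝ) (ha : Measurable a)
    (hbd : ∀ t : ℝ, 0 < t → ‖a t‖ ≤ M) (T : ℝ) (hT : 0 < T) (z : ℂ) :
    IntervalIntegrable (fun t : ℝ => a t * Complex.exp (-z * t)) volume 0 T := by
  rw [intervalIntegrable_iff_integrableOn_Ioc_of_le hT.le]
  refine Integrable.bdd_mul (c := M) ?_ ha.aestronglyMeasurable ?_
  · exact (Continuous.integrableOn_Icc (by fun_prop)).mono_set Ioc_subset_Icc_self
  · filter_upwards [ae_restrict_mem measurableSet_Ioc] with t ht using hbd t ht.1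

lemma fT_diff (a : ℝ → ℂ) (M : ℝ) (ha : Measurable a)
    (hbd : ∀ t : ℝ, 0 < t → ‖a t‖ ≤ M) (T : ℝ) (hT : 0 < T) :
    Differentiable ℂ (fun z : ℂ => ∫ t in (0:ℝ)..T, a t * Complex.exp (-z * t)) := by
  intro z
  have hM : 0 ≤ M := (norm_nonneg _).trans (hbd 1 one_pos)
  refine (intervalIntegral.hasDerivAt_integral_of_dominated_loc_of_deriv_le
    (F' := fun z t => a t * (Complex.exp (-z * t) * (-t)))
    (bound := fun t => M * (Real.exp ((‖z‖ + 1) * T) * T))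
    (Metric.ball_mem_nhds z one_pos) ?_ (intgA a M ha hbd T hT z) ?_ ?_ ?_ ?_).2.differentiableAt
  · filter_upwards with x
    exact (ha.mul (by fun_prop)).aestronglyMeasurable
  · exact (ha.mul (by fun_prop)).aestronglyMeasurable
  · filter_upwards with t ht x hx
    rw [uIoc_of_le hT.le] at ht
    have h1 : ‖x‖ ≤ ‖z‖ + 1 := by
      have := norm_sub_norm_le x z
      rw [Metric.mem_ball, dist_eq_norm] at hx
      linarith
    rw [norm_mul, norm_mul, norm_neg, Complex.norm_exp, Complex.norm_real, Real.norm_of_nonneg ht.1.le]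
    have h2 : (-x * (t:ℂ)).re ≤ (‖z‖ + 1) * T := by
      have : (-x * (t:ℂ)).re ≤ ‖-x * (t:ℂ)‖ := Complex.re_le_norm _
      rw [norm_mul, norm_neg, Complex.norm_real, Real.norm_of_nonneg ht.1.le] at this
      refine this.trans ?_
      have := ht.1.le
      have := ht.2
      gcongr
    have := hbd t ht.1
    have := ht.2
    have := ht.1.le
    gcongr
  · exact intervalIntegrable_const
  · filter_upwards with t ht x hx
    have : HasDerivAt (fun x : ℂ => -x * (t:ℂ)) (-(t:ℂ)) x := by
      simpa using ((hasDerivAt_id x).neg.mul_const (t:ℂ))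
    exact (this.cexp).const_mul _

lemma boundR (a : ℝ → ℂ) (M : ℝ) (ha : Measurable a)
    (hbd : ∀ t : ℝ, 0 < t → ‖a t‖ ≤ M) (T : ℝ) (hT : 0 < T) (z : ℂ) (hz : 0 < z.re) :
    ‖(∫ t in (0:ℝ)..T, a t * Complex.exp (-z * t)) - ∫ t in Ioi (0 : ℝ), a t * Complex.exp (-z * t)‖
      ≤ M * Real.exp (-z.re * T) / z.re := by
  have hi : IntegrableOn (fun t : ℝ => a t * Complex.exp (-z * t)) (Ioi 0) := by
    refine Integrable.bdd_mul (c := M) ?_ ha.aestronglyMeasurable ?_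
    · exact integrableOn_exp_mul_complex_Ioi (by simpa using hz) 0
    · filter_upwards [ae_restrict_mem measurableSet_Ioi] with t ht using hbd t ht
  have h1 := intervalIntegral.integral_interval_add_Ioi hi (hi.mono_set (Ioi_subset_Ioi hT.le))
  rw [← h1, sub_add_cancel_left, norm_neg]
  have h2 : ∫ t in Ioi T, M * Real.exp (-z.re * t) = M * Real.exp (-z.re * T) / z.re := by
    rw [MeasureTheory.integral_const_mul, integral_exp_mul_Ioi (by linarith) T]
    field_simp
  rw [← h2]
  refine norm_integral_le_of_norm_le ((integrableOn_exp_mul_Ioi (by linarith) T).const_mul M) ?_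
  filter_upwards [ae_restrict_mem measurableSet_Ioi] with t ht
  rw [norm_mul, Complex.norm_exp]
  have := hbd t (hT.trans ht)
  have h3 : (-z * (t:ℂ)).re = -z.re * t := by simp
  rw [h3]
  gcongr

lemma boundL (a : ℝ → ℂ) (M : ℝ) 
    (hbd : ∀ t : ℝ, 0 < t → ‖a t‖ ≤ M) (T : ℝ) (hT : 0 < T) (z : ℂ) (hz : z.re < 0) :
    ‖(∫ t in (0:ℝ)..T, a t * Complex.exp (-z * t))‖
      ≤ M * Real.exp (-z.re * T) / (-z.re) := by
  have hM : 0 ≤ M := (norm_nonneg _).trans (hbd 1 one_pos)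
  have h2 : ∫ t in (0:ℝ)..T, M * Real.exp (-z.re * t) = M * (Real.exp (-z.re * T) - 1) / (-z.re) := by
    rw [intervalIntegral.integral_const_mul,
      intervalIntegral.integral_comp_mul_left (fun x => Real.exp x) (by linarith : -z.re ≠ 0 )]
    simp
    field_simp
  have h4 : ‖(∫ t in (0:ℝ)..T, a t * Complex.exp (-z * t))‖ ≤ ∫ t in (0:ℝ)..T, M * Real.exp (-z.re * t) := by
    refine intervalIntegral.norm_integral_le_of_norm_le hT.le ?_ (Continuous.intervalIntegrable (by fun_prop) _ _)
    filter_upwards with t ht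
    rw [norm_mul, Complex.norm_exp]
    have := hbd t ht.1
    have h3 : (-z * (t:ℂ)).re = -z.re * t := by simp
    rw [h3]
    gcongr
  rw [h2] at h4
  refine h4.trans ?_
  have : 0 < -z.re := by linarith
  gcongr
  linarith

lemma kernel_norm (R : ℝ) (hR : 0 < R) (θ : ℝ) :
    ‖1 + (circleMap 0 R θ)^2 / (R:ℂ)^2‖ = 2 * |Real.cos θ| := by
  have hR' : (R:ℂ) ≠ 0 := by exact_mod_cast hR.ne'
  have : 1 + (circleMap 0 R θ)^2 / (R:ℂ)^2 = Complex.exp (θ * I) * ((2 * Real.cos θ : ℝ) : ℂ) := by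
    simp only [circleMap, zero_add]
    push_cast
    rw [Complex.two_cos, mul_add, ← Complex.exp_add, ← Complex.exp_add]
    have : (R:ℂ)^2 ≠ 0 := pow_ne_zero _ hR'
    rw [mul_pow, mul_div_cancel_left₀ _ this, ← Complex.exp_nat_mul]
    ring_nf
    simp
    ring
  rw [this, norm_mul, Complex.norm_exp_ofReal_mul_I, Complex.norm_real, Real.norm_eq_abs, abs_mul]
  simp

lemma half_disc (R : ℝ) (hR : 0 < R) (W : Set ℂ) (hW : IsOpen W)
    (hsub : ∀ z : ℂ, 0 ≤ z.re → ‖z‖ ≤ R → z ∈ W) (g : ℂ → ℂ) (hg : DifferentiableOn ℂ g W) :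
    (∫ θ in (-(π/2))..(π/2), g (circleMap 0 R θ) * (circleMap 0 R θ * I))
      = ∫ y in (-R)..R, g (I * y) * I := by
  set K : Set ℂ := Metric.closedBall 0 R ∩ {z : ℂ | 0 ≤ z.re} with hK
  have hKc : IsCompact K := (isCompact_closedBall _ _).inter_right
    (isClosed_le continuous_const Complex.continuous_re)
  have hKv : Convex ℝ K := (convex_closedBall _ _).inter (convex_halfSpace_re_ge 0)
  obtain ⟨δ, hδ, hsubW⟩ := hKc.exists_thickening_subset_open hW
    (fun z hz => hsub z hz.2 (by simpa using hz.1))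
  obtain ⟨G, hG⟩ := (hKv.thickening δ).exists_forall_hasDerivWithinAt (hg.mono hsubW)
  have hGd : ∀ z ∈ K, HasDerivAt G (g z) z := fun z hz => by
    have hz' := Metric.self_subset_thickening hδ K hz
    exact (hG z hz').hasDerivAt (Metric.isOpen_thickening.mem_nhds hz')
  have hgc : ContinuousOn g K := hg.continuousOn.mono 
    ((Metric.self_subset_thickening hδ K).trans hsubW)
  have hc : ∀ θ ∈ uIcc (-(π/2)) (π/2), circleMap 0 R θ ∈ K := by
    intro θ hθ
    rw [uIcc_of_le (by linarith [pi_pos])] at hθ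
    refine ⟨circleMap_mem_closedBall _ hR.le _, ?_⟩
    have := Real.cos_nonneg_of_mem_Icc hθ
    simp [circleMap_zero]
    positivity
  have hl : ∀ y ∈ uIcc (-R) R, I * (y:ℂ) ∈ K := by
    intro y hy
    rw [uIcc_of_le (by linarith)] at hy
    exact ⟨by simpa [abs_le] using hy, by simp⟩
  rw [intervalIntegral.integral_eq_sub_of_hasDerivAt (f := fun θ => G (circleMap 0 R θ)),
    intervalIntegral.integral_eq_sub_of_hasDerivAt (f := fun y : ℝ => G (I * y))]
  · congr 2 <;> simp [circleMap_zero] 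
    · ring
    · rw [show -((π:ℂ) / 2 * I) = -((π:ℂ) / 2 * I) from rfl, Complex.exp_neg]
      simp
      ring
  · intro y hy
    have : HasDerivAt (fun y : ℝ => I * (y:ℂ)) I y := by
      simpa using (Complex.ofRealCLM.hasDerivAt (x := y)).const_mul I
    exact (hGd _ (hl y hy)).comp y this
  · refine ContinuousOn.intervalIntegrable (ContinuousOn.mul (hgc.comp (by fun_prop) hl) (by fun_prop))
  · intro y hy
    have := hasDerivAt_circleMap 0 R y
    exact (hGd _ (hc y hy)).comp y this
  · refine ContinuousOn.intervalIntegrable (ContinuousOn.mul (hgc.comp (by fun_prop) hc) (by fun_prop))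

lemma full_circle (R : ℝ) (hR : 0 < R) (g : ℂ → ℂ) (hg : Differentiable ℂ g) :
    (∫ θ in (-(π/2))..(π/2), g (circleMap 0 R θ) * I) +
    (∫ θ in (π/2)..(3*π/2), g (circleMap 0 R θ) * I) = 2 * π * I * g 0 := by
  have h := Complex.circleIntegral_sub_inv_smul_of_differentiable_on_off_countable
    (R := R) (c := 0) (w := 0) (f := g) countable_empty (by simpa using hR) 
    hg.continuous.continuousOn (fun x _ => hg x)
  have hcont : Continuous (fun θ => g (circleMap 0 R θ) * I) := 
    (hg.continuous.comp (continuous_circleMap 0 R)).mul continuous_const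
  rw [intervalIntegral.integral_add_adjacent_intervals (hcont.intervalIntegrable _ _) (hcont.intervalIntegrable _ _)]
  have hp : Function.Periodic (fun θ => g (circleMap 0 R θ) * I) (2 * π) := fun θ => by
    simp only [periodic_circleMap 0 R θ]
  have := hp.intervalIntegral_add_eq (-(π/2)) 0
  rw [show -(π/2) + 2 * π = 3 * π / 2 by ring, zero_add] at this
  rw [this, ← smul_eq_mul (a := 2 * (π:ℂ) * I), ← h, circleIntegral]
  refine intervalIntegral.integral_congr fun θ _ => ?_
  have : circleMap 0 R θ ≠ 0 := circleMap_ne_center hR.ne'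
  simp only [deriv_circleMap, sub_zero, smul_eq_mul]
  field_simp


/-- Proposition 3.1 (Newman's contour estimate): if the Laplace transform of the
bounded function `a` extends analytically to a neighborhood of the segment
`[-iR, iR]`, then for every `T > 0`,
`|∫₀ᵀ a - f(0)| ≤ 2M/R + |f(0)|/(eRT) + (1/2π)|∫_{-R}^R (f(iy)-f(0))(1/(iy)+iy/R²)e^{iTy} dy|`. -/
theorem stmt_4 (a : ℝ → ℂ) (M R : ℝ) (hR : 0 < R) (ha : Measurable a)
    (hbd : ∀ t : ℝ, 0 < t → ‖a t‖ ≤ M)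
    (F : ℂ → ℂ) (U : Set ℂ) (hU : IsOpen U)
    (hseg : {z : ℂ | z.re = 0 ∧ |z.im| ≤ R} ⊆ U)
    (hF : DifferentiableOn ℂ F (U ∪ {z : ℂ | 0 < z.re}))
    (hFeq : ∀ z : ℂ, 0 < z.re →
      F z = ∫ t in Ioi (0 : ℝ), a t * Complex.exp (-z * t)) :
    ∀ T : ℝ, 0 < T →
      ‖(∫ t in (0 : ℝ)..T, a t) - F 0‖ ≤
        2 * M / R + ‖F 0‖ / (Real.exp 1 * R * T) +
        (1 / (2 * Real.pi)) *
          ‖∫ y in (-R)..R,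
              (F (Complex.I * y) - F 0) *
                (1 / (Complex.I * y) + Complex.I * y / (R : ℂ) ^ 2) *
                Complex.exp (Complex.I * T * y)‖ := by
  intro T hT
  have hM : 0 ≤ M := (norm_nonneg _).trans (hbd 1 one_pos)
  have hπ := Real.pi_pos
  set W : Set ℂ := U ∪ {z : ℂ | 0 < z.re} with hWdef
  have hW : IsOpen W := hU.union (isOpen_lt continuous_const Complex.continuous_re)
  have hsub : ∀ z : ℂ, 0 ≤ z.re → ‖z‖ ≤ R → z ∈ W := by
    intro z hz hzR
    rcases hz.lt_or_eq with h | h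
    · exact Or.inr h
    · exact Or.inl (hseg ⟨h.symm, (Complex.abs_im_le_norm z).trans hzR⟩)
  have h0W : W ∈ nhds (0:ℂ) := hW.mem_nhds (hsub 0 (by simp) (by simpa using hR.le))
  set k : ℂ → ℂ := fun z => (1 + z ^ 2 / (R:ℂ) ^ 2) * Complex.exp (z * T) with hk
  have hkd : Differentiable ℂ k := by rw [hk]; fun_prop
  set fT : ℂ → ℂ := fun z : ℂ => ∫ t in (0:ℝ)..T, a t * Complex.exp (-z * t) with hfT
  have hfTd : Differentiable ℂ fT := fT_diff a M ha hbd T hT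
  have h1 := full_circle R hR (fun z => fT z * k z) (hfTd.mul hkd)
  have h2 := full_circle R hR k hkd
  have h3 := half_disc R hR W hW hsub (fun z => dslope F 0 z * k z)
    (((Complex.differentiableOn_dslope h0W).2 hF).mul hkd.differentiableOn)
  have hk0 : k 0 = 1 := by simp [hk]
  have hfT0 : fT 0 = ∫ t in (0 : ℝ)..T, a t := by simp [hfT]
  simp only [hk0, mul_one] at h1 h2
  set J := ∫ y in (-R)..R,
              (F (Complex.I * y) - F 0) *
                (1 / (Complex.I * y) + Complex.I * y / (R : ℂ) ^ 2) *
                Complex.exp (Complex.I * T * y) with hJ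
  have hds : ∀ z : ℂ, z ≠ 0 → dslope F 0 z = (F z - F 0) / z := by
    intro z hz
    rw [dslope_of_ne _ hz, slope_def_field, sub_zero]
  have h3l : (∫ θ in (-(π/2))..(π/2), dslope F 0 (circleMap 0 R θ) * k (circleMap 0 R θ) *
      (circleMap 0 R θ * I)) =
      ∫ θ in (-(π/2))..(π/2), (F (circleMap 0 R θ) - F 0) * k (circleMap 0 R θ) * I := by
    refine intervalIntegral.integral_congr fun θ _ => ?_
    have : circleMap 0 R θ ≠ 0 := circleMap_ne_center hR.ne'
    simp only [hds _ this]
    field_simp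
  have h3r : (∫ y in (-R)..R, dslope F 0 (I * y) * k (I * y) * I) = J * I := by
    rw [intervalIntegral.integral_mul_const]
    congr 1
    refine intervalIntegral.integral_congr_ae ?_
    have : ∀ᵐ y : ℝ, y ≠ 0 := by simp [ae_iff]
    filter_upwards [this] with y hy _
    have hy' : (y:ℂ) ≠ 0 := by exact_mod_cast hy
    have hIy : I * (y:ℂ) ≠ 0 := mul_ne_zero I_ne_zero hy'
    rw [hds _ hIy]
    simp only [hk]
    rw [show I * (y:ℂ) * T = I * T * y by ring]
    generalize I * (y:ℂ) = w at *
    field_simp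
  rw [h3l, h3r] at h3
  have hcW : ContinuousOn (fun θ : ℝ => F (circleMap 0 R θ)) (uIcc (-(π/2)) (π/2)) := by
    refine hF.continuousOn.comp (by fun_prop) ?_
    intro θ hθ
    rw [uIcc_of_le (by linarith [pi_pos])] at hθ
    have := Real.cos_nonneg_of_mem_Icc hθ
    refine hsub _ ?_ ?_
    · simp [circleMap_zero]
      positivity
    · simp [abs_of_pos hR]
  have hkc : Continuous (fun θ : ℝ => k (circleMap 0 R θ)) := hkd.continuous.comp (by fun_prop)
  have hfc : Continuous (fun θ : ℝ => fT (circleMap 0 R θ)) := hfTd.continuous.comp (by fun_prop)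
  have i1 : IntervalIntegrable (fun θ => fT (circleMap 0 R θ) * k (circleMap 0 R θ) * I) volume
      (-(π/2)) (π/2) := Continuous.intervalIntegrable ((hfc.mul hkc).mul continuous_const) _ _
  have i2 : IntervalIntegrable (fun θ => F (circleMap 0 R θ) * k (circleMap 0 R θ) * I) volume
      (-(π/2)) (π/2) := ContinuousOn.intervalIntegrable
        ((hcW.mul hkc.continuousOn).mul continuousOn_const)
  have i3 : IntervalIntegrable (fun θ => F 0 * (k (circleMap 0 R θ) * I)) volume
      (-(π/2)) (π/2) := Continuous.intervalIntegrable (by fun_prop) _ _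
  have e1 : (∫ θ in (-(π/2))..(π/2), (F (circleMap 0 R θ) - F 0) * k (circleMap 0 R θ) * I) =
      (∫ θ in (-(π/2))..(π/2), F (circleMap 0 R θ) * k (circleMap 0 R θ) * I) -
      F 0 * ∫ θ in (-(π/2))..(π/2), k (circleMap 0 R θ) * I := by
    rw [← intervalIntegral.integral_const_mul, ← intervalIntegral.integral_sub i2 i3]
    congr 1
    ext θ
    ring
  have e2 : (∫ θ in (-(π/2))..(π/2), (fT (circleMap 0 R θ) - F (circleMap 0 R θ)) *
        k (circleMap 0 R θ) * I) =
      (∫ θ in (-(π/2))..(π/2), fT (circleMap 0 R θ) * k (circleMap 0 R θ) * I) -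
      ∫ θ in (-(π/2))..(π/2), F (circleMap 0 R θ) * k (circleMap 0 R θ) * I := by
    rw [← intervalIntegral.integral_sub i1 i2]
    congr 1
    ext θ
    ring
  have key : 2 * π * I * (fT 0 - F 0) =
      (∫ θ in (-(π/2))..(π/2), (fT (circleMap 0 R θ) - F (circleMap 0 R θ)) *
        k (circleMap 0 R θ) * I) +
      (∫ θ in (π/2)..(3*π/2), fT (circleMap 0 R θ) * k (circleMap 0 R θ) * I) + J * I -
      F 0 * ∫ θ in (π/2)..(3*π/2), k (circleMap 0 R θ) * I := by
    rw [e2]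
    linear_combination (-1 : ℂ) * h1 + F 0 * h2 + h3 - e1
  have hre : ∀ θ, (circleMap 0 R θ).re = R * Real.cos θ := by
    intro θ
    simp [circleMap_zero]
  have hkn : ∀ θ, ‖k (circleMap 0 R θ)‖ = 2 * |Real.cos θ| * Real.exp (R * Real.cos θ * T) := by
    intro θ
    simp only [hk]
    rw [norm_mul, kernel_norm R hR, Complex.norm_exp]
    congr 2
    simp [circleMap_zero]
  have B1 : ‖∫ θ in (-(π/2))..(π/2), (fT (circleMap 0 R θ) - F (circleMap 0 R θ)) *
        k (circleMap 0 R θ) * I‖ ≤ 2 * M / R * |π/2 - -(π/2)| := by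
    refine intervalIntegral.norm_integral_le_of_norm_le_const fun θ hθ => ?_
    rw [uIoc_of_le (by linarith)] at hθ
    have hc := Real.cos_nonneg_of_mem_Icc (Ioc_subset_Icc_self hθ)
    rw [norm_mul, norm_mul, hkn, Complex.norm_I, mul_one, abs_of_nonneg hc]
    rcases hc.lt_or_eq with hc | hc
    · have hz : 0 < (circleMap 0 R θ).re := by rw [hre]; positivity
      have := boundR a M ha hbd T hT _ hz
      rw [← hFeq _ hz, hre] at this
      calc _ ≤ M * Real.exp (-(R * Real.cos θ) * T) / (R * Real.cos θ) *
            (2 * Real.cos θ * Real.exp (R * Real.cos θ * T)) := by gcongr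
        _ = 2 * M / R * (Real.exp (-(R * Real.cos θ) * T) * Real.exp (R * Real.cos θ * T)) := by
            field_simp
        _ = _ := by rw [← Real.exp_add]; simp
        _ ≤ _ := le_rfl
    · rw [← hc]
      simp
      positivity
  have hcL : ∀ θ ∈ Set.uIoc (π/2) (3*π/2), Real.cos θ ≤ 0 := by
    intro θ hθ
    rw [uIoc_of_le (by linarith)] at hθ
    exact Real.cos_nonpos_of_pi_div_two_le_of_le hθ.1.le (by linarith [hθ.2])
  have B2 : ‖∫ θ in (π/2)..(3*π/2), fT (circleMap 0 R θ) * k (circleMap 0 R θ) * I‖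
      ≤ 2 * M / R * |3*π/2 - π/2| := by
    refine intervalIntegral.norm_integral_le_of_norm_le_const fun θ hθ => ?_
    have hc := hcL θ hθ
    rw [norm_mul, norm_mul, hkn, Complex.norm_I, mul_one, abs_of_nonpos hc]
    rcases hc.lt_or_eq with hc | hc
    · have hz : (circleMap 0 R θ).re < 0 := by rw [hre]; exact mul_neg_of_pos_of_neg hR hc
      have := boundL a M hbd T hT _ hz
      rw [hre] at this
      have hc' : 0 < -Real.cos θ := by linarith
      have hc0 : Real.cos θ ≠ 0 := hc.ne
      calc _ ≤ M * Real.exp (-(R * Real.cos θ) * T) / (-(R * Real.cos θ)) *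
            (2 * -Real.cos θ * Real.exp (R * Real.cos θ * T)) := by gcongr
        _ = 2 * M / R * (Real.exp (-(R * Real.cos θ) * T) * Real.exp (R * Real.cos θ * T)) := by
            field_simp
        _ = _ := by rw [← Real.exp_add]; simp
        _ ≤ _ := le_rfl
    · rw [hc]
      simp
      positivity
  have B3 : ‖∫ θ in (π/2)..(3*π/2), k (circleMap 0 R θ) * I‖
      ≤ 2 / (Real.exp 1 * R * T) * |3*π/2 - π/2| := by
    refine intervalIntegral.norm_integral_le_of_norm_le_const fun θ hθ => ?_
    have hc := hcL θ hθ
    rw [norm_mul, hkn, Complex.norm_I, mul_one, abs_of_nonpos hc]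
    have h5 := Real.add_one_le_exp (-(R * Real.cos θ * T) - 1)
    rw [Real.exp_sub, Real.exp_neg, le_div_iff₀ (Real.exp_pos 1)] at h5
    rw [le_div_iff₀ (by positivity)]
    have h6 : 0 < Real.exp (R * Real.cos θ * T) := Real.exp_pos _
    have h7 := mul_le_mul_of_nonneg_right h5 h6.le
    rw [inv_mul_cancel₀ h6.ne'] at h7
    linarith
  rw [show |π/2 - -(π/2)| = π by rw [abs_of_pos] <;> linarith] at B1
  rw [show |3*π/2 - π/2| = π by rw [abs_of_pos] <;> linarith] at B2 B3
  have hn := congrArg norm key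
  rw [norm_mul] at hn
  have h2pi : ‖2 * (π:ℂ) * I‖ = 2 * π := by simp [abs_of_pos hπ]
  rw [h2pi, hfT0] at hn
  have B4 : ‖F 0 * ∫ θ in (π/2)..(3*π/2), k (circleMap 0 R θ) * I‖ ≤
      ‖F 0‖ * (2 / (Real.exp 1 * R * T) * π) := by
    rw [norm_mul]; gcongr
  have B5 : ‖J * I‖ = ‖J‖ := by simp
  have tri := (norm_sub_le ((∫ θ in (-(π/2))..(π/2), (fT (circleMap 0 R θ) - F (circleMap 0 R θ)) *
        k (circleMap 0 R θ) * I) +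
      (∫ θ in (π/2)..(3*π/2), fT (circleMap 0 R θ) * k (circleMap 0 R θ) * I) + J * I)
      (F 0 * ∫ θ in (π/2)..(3*π/2), k (circleMap 0 R θ) * I)).trans
      (add_le_add_left (norm_add₃_le (a := ∫ θ in (-(π/2))..(π/2), (fT (circleMap 0 R θ) - F (circleMap 0 R θ)) *
        k (circleMap 0 R θ) * I) (b := ∫ θ in (π/2)..(3*π/2), fT (circleMap 0 R θ) * k (circleMap 0 R θ) * I) (c := J * I)) _)
  rw [← hn, B5] at tri
  refine le_of_mul_le_mul_left ?_ (by positivity : 0 < 2 * π)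
  have : 2 * π * (2 * M / R + ‖F 0‖ / (Real.exp 1 * R * T) + 1 / (2 * π) * ‖J‖) =
      2 * M / R * π + 2 * M / R * π + ‖J‖ + ‖F 0‖ * (2 / (Real.exp 1 * R * T) * π) := by
    field_simp
    ring
  rw [this]
  linarith
end

section
/- Let a : [0,∞) → ℂ be measurable and bounded with M = sup_{t>0} |a(t)|, and suppose the Laplace transform f(z) = ∫₀^∞ a(t)e^{-zt} dt has an analytic extension to the open segment (-iB, iB) of the imaginary axis (B > 0). Then limsup_{T→∞} |∫₀^T a(t) dt - f(0)| ≤ 2M/B. -/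
open MeasureTheory Complex Set Filter

open scoped Topology Real in
lemma aux_halfdisc (g : ℂ → ℂ) (R : ℝ) (hR : 0 < R)
    (hg : DifferentiableOn ℂ g {z : ℂ | 0 ≤ z.re ∧ ‖z‖ ≤ R}) :
    ∫ θ in (-(π/2))..(π/2), g (circleMap 0 R θ) * circleMap 0 R θ
      = ∫ y in (-R)..R, g (y * I) := by
  set D : Set ℂ := {z : ℂ | 0 ≤ z.re ∧ ‖z‖ ≤ R} with hD
  have hDc : IsCompact D := by
    have : D = Metric.closedBall 0 R ∩ {z : ℂ | 0 ≤ z.re} := by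
      ext z; simp [hD, and_comm]
    rw [this]
    exact (isCompact_closedBall _ _).inter_right (isClosed_le continuous_const continuous_re)
  obtain ⟨C, hC⟩ := hDc.exists_bound_of_continuousOn hg.continuousOn
  have hC0 : 0 ≤ C := (norm_nonneg _).trans (hC 0 (by simp [hD, hR.le]))
  have hgc : ContinuousOn g D := hg.continuousOn
  have hgI : ContinuousOn (fun y : ℝ => g (y * I)) (Icc (-R) R) := by
    refine hgc.comp (by fun_prop) ?_
    intro y hy
    simp [hD, abs_le, hy.1, hy.2]
  have hgI' : ContinuousOn (fun y : ℝ => g (-(y * I))) (Icc (-R) R) := by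
    refine hgc.comp (by fun_prop) ?_
    intro y hy
    simp [hD, abs_le, hy.1, hy.2]
  -- rectangle
  have key : ∀ ε : ℝ, 0 < ε → ε ≤ R →
      (∫ θ in (-(π/2))..(π/2), g (circleMap 0 R θ) * circleMap 0 R θ)
      = (∫ y in ε..R, g (y * I)) + (∫ y in ε..R, g (-(y * I)))
        + ∫ θ in (-(π/2))..(π/2), g (circleMap 0 ε θ) * circleMap 0 ε θ := by
    intro ε hε hεR
    have hlog : Real.log ε ≤ Real.log R := Real.log_le_log hε hεR
    have H := integral_boundary_rect_eq_zero_of_differentiableOn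
      (fun w => g (exp w) * exp w) (⟨Real.log ε, -(π/2)⟩) (⟨Real.log R, π/2⟩) (by
        refine DifferentiableOn.mul (hg.comp (by fun_prop) ?_) (by fun_prop)
        intro w hw
        rw [mem_reProdIm] at hw
        dsimp only at hw
        rw [uIcc_of_le hlog, uIcc_of_le (by linarith [Real.pi_pos])] at hw
        obtain ⟨h1, h2⟩ := hw
        refine ⟨?_, ?_⟩
        · rw [exp_re]
          exact mul_nonneg (Real.exp_pos _).le (Real.cos_nonneg_of_mem_Icc h2)
        · rw [norm_exp]
          calc _ ≤ Real.exp (Real.log R) := Real.exp_le_exp.2 h1.2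
            _ = R := Real.exp_log hR)
    dsimp only at H
    have e1 : ∀ r : ℝ, 0 < r → ∀ y : ℝ, exp ((Real.log r : ℂ) + y * I) = circleMap 0 r y := by
      intro r hr y
      rw [Complex.exp_add, ← ofReal_exp, Real.exp_log hr, circleMap]; simp
    simp only [e1 R hR, e1 ε hε] at H
    have e2 : ∀ x : ℝ, exp ((x : ℂ) + ((π/2 : ℝ) : ℂ) * I) = Real.exp x * I := by
      intro x
      rw [Complex.exp_add]; push_cast; rw [exp_pi_div_two_mul_I]
    have e3 : ∀ x : ℝ, exp ((x : ℂ) + ((-(π/2) : ℝ) : ℂ) * I) = -(Real.exp x * I) := by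
      intro x
      have : ((-(π/2) : ℝ) : ℂ) * I = -(π / 2 * I) := by push_cast; ring
      rw [Complex.exp_add, this, Complex.exp_neg, exp_pi_div_two_mul_I]; simp
    simp only [e2, e3] at H
    have sub : ∀ k : ℝ → ℂ, ContinuousOn k (Icc (-R) R) →
        ∫ x in (Real.log ε)..(Real.log R), (Real.exp x) • k (Real.exp x) = ∫ y in ε..R, k y := by
      intro k hk
      have := intervalIntegral.integral_deriv_smul_comp' (a := Real.log ε) (b := Real.log R)
        (f := Real.exp) (f' := Real.exp) (g := k)
        (fun x _ => Real.hasDerivAt_exp x) Real.continuous_exp.continuousOn (hk.mono ?_)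
      · simpa [Real.exp_log hε, Real.exp_log hR, Function.comp_def] using this
      · rintro _ ⟨x, hx, rfl⟩
        rw [uIcc_of_le hlog] at hx
        constructor
        · linarith [Real.exp_pos x]
        · calc _ ≤ Real.exp (Real.log R) := Real.exp_le_exp.2 hx.2
            _ = R := Real.exp_log hR
    have s1 := sub _ hgI
    have s2 := sub _ hgI'
    have t1 : (∫ x in (Real.log ε)..(Real.log R), g ((Real.exp x) * I) * ((Real.exp x) * I))
        = I * ∫ y in ε..R, g (y * I) := by
      rw [← s1, ← intervalIntegral.integral_const_mul]
      congr 1; ext x; rw [real_smul]; ring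
    have t2 : (∫ x in (Real.log ε)..(Real.log R), g (-((Real.exp x) * I)) * (-((Real.exp x) * I)))
        = -(I * ∫ y in ε..R, g (-(y * I))) := by
      rw [← s2, ← intervalIntegral.integral_const_mul, ← intervalIntegral.integral_neg]
      congr 1; ext x; rw [real_smul]; ring
    rw [t1, t2] at H
    simp only [smul_eq_mul] at H
    apply mul_left_cancel₀ I_ne_zero
    linear_combination H
  have ci : ∀ k : ℝ → ℂ, ContinuousOn k (Icc (-R) R) → ∀ x ∈ Icc (-R) R, ∀ y ∈ Icc (-R) R,
      IntervalIntegrable k volume x y := by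
    intro k hk x hx y hy
    exact (hk.mono (by rw [uIcc_eq_union]; exact union_subset (Icc_subset_Icc hx.1 hy.2) (Icc_subset_Icc hy.1 hx.2))).intervalIntegrable
  have key2 : ∀ ε : ℝ, 0 < ε → ε ≤ R →
      ‖(∫ θ in (-(π/2))..(π/2), g (circleMap 0 R θ) * circleMap 0 R θ)
        - ∫ y in (-R)..R, g (y * I)‖ ≤ (C + C + C * π) * ε := by
    intro ε hε hεR
    have m0 : (0:ℝ) ∈ Icc (-R) R := ⟨by linarith, hR.le⟩
    have mR : R ∈ Icc (-R) R := ⟨by linarith, le_rfl⟩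
    have mR' : -R ∈ Icc (-R) R := ⟨le_rfl, by linarith⟩
    have mε : ε ∈ Icc (-R) R := ⟨by linarith, hεR⟩
    rw [key ε hε hεR]
    have a1 := intervalIntegral.integral_add_adjacent_intervals (ci _ hgI _ m0 _ mε) (ci _ hgI _ mε _ mR)
    have a2 := intervalIntegral.integral_add_adjacent_intervals (ci _ hgI' _ m0 _ mε) (ci _ hgI' _ mε _ mR)
    have a3 := intervalIntegral.integral_add_adjacent_intervals (ci _ hgI _ mR' _ m0) (ci _ hgI _ m0 _ mR)
    have a4 : (∫ y in (0:ℝ)..R, g (-(y * I))) = ∫ y in (-R)..0, g (y * I) := by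
      have := intervalIntegral.integral_comp_neg (a := 0) (b := R) (fun y : ℝ => g (y * I))
      simpa using this
    have b1 : ‖∫ y in (0:ℝ)..ε, g (y * I)‖ ≤ C * |ε - 0| := by
      apply intervalIntegral.norm_integral_le_of_norm_le_const
      intro y hy
      rw [uIoc_of_le hε.le] at hy
      apply hC
      simp [hD, abs_le]; constructor <;> linarith [hy.1, hy.2]
    have b2 : ‖∫ y in (0:ℝ)..ε, g (-(y * I))‖ ≤ C * |ε - 0| := by
      apply intervalIntegral.norm_integral_le_of_norm_le_const
      intro y hy
      rw [uIoc_of_le hε.le] at hy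
      apply hC
      simp [hD, abs_le]; constructor <;> linarith [hy.1, hy.2]
    have b3 : ‖∫ θ in (-(π/2))..(π/2), g (circleMap 0 ε θ) * circleMap 0 ε θ‖
        ≤ (C * ε) * |π/2 - -(π/2)| := by
      apply intervalIntegral.norm_integral_le_of_norm_le_const
      intro y hy
      rw [uIoc_of_le (by linarith [Real.pi_pos])] at hy
      rw [norm_mul]
      have hn : ‖circleMap 0 ε y‖ = ε := by simp [abs_of_pos hε]
      rw [hn]
      gcongr
      apply hC
      refine ⟨?_, by rw [hn]; exact hεR⟩
      have : (circleMap 0 ε y).re = ε * Real.cos y := by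
        simp [circleMap, exp_ofReal_mul_I_re]
      rw [this]
      exact mul_nonneg hε.le (Real.cos_nonneg_of_mem_Icc ⟨hy.1.le, hy.2⟩)
    have : (∫ y in ε..R, g (y * I)) + (∫ y in ε..R, g (-(y * I)))
        + (∫ θ in (-(π/2))..(π/2), g (circleMap 0 ε θ) * circleMap 0 ε θ) - (∫ y in (-R)..R, g (y * I))
        = (∫ θ in (-(π/2))..(π/2), g (circleMap 0 ε θ) * circleMap 0 ε θ)
          - (∫ y in (0:ℝ)..ε, g (y * I)) - (∫ y in (0:ℝ)..ε, g (-(y * I))) := by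
      rw [← a3, ← a4, ← a1, ← a2]; ring
    rw [this]
    refine (norm_sub_le _ _).trans ?_
    refine (add_le_add_left (norm_sub_le _ _) _).trans ?_
    rw [show π/2 - -(π/2) = π by ring, abs_of_pos Real.pi_pos] at b3
    rw [sub_zero, abs_of_pos hε] at b1 b2
    nlinarith
  rw [← sub_eq_zero, ← norm_le_zero_iff]
  have ht : Tendsto (fun ε : ℝ => (C + C + C * π) * ε) (𝓝[>] 0) (𝓝 0) := by
    have : Tendsto (fun ε : ℝ => (C + C + C * π) * ε) (𝓝 0) (𝓝 ((C + C + C * π) * 0)) :=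
      (continuous_const.mul continuous_id).tendsto 0
    rw [mul_zero] at this
    exact this.mono_left nhdsWithin_le_nhds
  refine ge_of_tendsto ht ?_
  filter_upwards [Ioc_mem_nhdsGT hR] with ε hε
  exact key2 ε hε.1 hε.2

lemma aux_intble (a : ℝ → ℂ) (M : ℝ) (ha : Measurable a)
    (hbd : ∀ t : ℝ, 0 < t → ‖a t‖ ≤ M) (T : ℝ) (hT : 0 ≤ T) (k : ℝ → ℂ) (hk : Continuous k) :
    IntervalIntegrable (fun t => a t * k t) volume 0 T := by
  have h : IntervalIntegrable a volume 0 T := by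
    rw [intervalIntegrable_iff_integrableOn_Ioc_of_le hT]
    refine Measure.integrableOn_of_bounded (M := M) (by simp) ha.aestronglyMeasurable ?_
    filter_upwards [ae_restrict_mem measurableSet_Ioc] with t ht using hbd t ht.1
  exact h.mul_continuousOn hk.continuousOn

lemma aux_entire (a : ℝ → ℂ) (M : ℝ) (ha : Measurable a)
    (hbd : ∀ t : ℝ, 0 < t → ‖a t‖ ≤ M) (T : ℝ) (hT : 0 ≤ T) :
    Differentiable ℂ (fun z : ℂ => ∫ t in (0:ℝ)..T, a t * exp (-z * t)) := by
  intro z₀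
  have hM : 0 ≤ M := (norm_nonneg _).trans (hbd 1 one_pos)
  refine (intervalIntegral.hasDerivAt_integral_of_dominated_loc_of_deriv_le
    (F := fun z t => a t * exp (-z * t)) (F' := fun z t => a t * (exp (-z * t) * (-t)))
    (bound := fun t => M * (Real.exp ((‖z₀‖ + 1) * T) * T))
    (Metric.ball_mem_nhds z₀ one_pos) ?_ ?_ ?_ ?_ ?_ ?_).2.differentiableAt
  · refine Eventually.of_forall fun z => ?_
    exact (ha.mul (by fun_prop)).aestronglyMeasurable
  · exact aux_intble a M ha hbd T hT _ (by fun_prop)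
  · exact (ha.mul (by fun_prop)).aestronglyMeasurable
  · refine Eventually.of_forall fun t ht z hz => ?_
    rw [uIoc_of_le hT] at ht
    rw [norm_mul, norm_mul, norm_exp, norm_neg, norm_real, Real.norm_eq_abs, abs_of_pos ht.1]
    have h1 : (-z * t).re ≤ (‖z₀‖ + 1) * T := by
      have : ‖-z * t‖ ≤ (‖z₀‖ + 1) * T := by
        rw [norm_mul, norm_neg, norm_real, Real.norm_eq_abs, abs_of_pos ht.1]
        have hz' : ‖z‖ ≤ ‖z₀‖ + 1 := by
          have := norm_sub_norm_le z z₀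
          rw [Metric.mem_ball, dist_eq_norm] at hz
          linarith
        exact mul_le_mul hz' ht.2 ht.1.le (by positivity)
      exact (re_le_norm _).trans this
    have ht0 := ht.1.le
    gcongr
    · exact hbd t ht.1
    · exact ht.2
  · exact intervalIntegrable_const
  · refine Eventually.of_forall fun t ht z hz => ?_
    have : HasDerivAt (fun z : ℂ => -z * t) (-t) z := by
      simpa using (hasDerivAt_id z).neg.mul_const (t:ℂ)
    exact this.cexp.const_mul (a t)

/-- tail bound -/
lemma aux_right (a : ℝ → ℂ) (M : ℝ) (ha : Measurable a)
    (hbd : ∀ t : ℝ, 0 < t → ‖a t‖ ≤ M) (T : ℝ) (hT : 0 ≤ T) (z : ℂ) (hz : 0 < z.re) :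
    ‖(∫ t in (0:ℝ)..T, a t * exp (-z * t)) - ∫ t in Ioi (0 : ℝ), a t * exp (-z * t)‖
      ≤ M * Real.exp (-z.re * T) / z.re := by
  have hb : ∀ t : ℝ, 0 < t → ‖a t * exp (-z * t)‖ ≤ M * Real.exp (-z.re * t) := by
    intro t ht
    rw [norm_mul, norm_exp]
    have : (-z * t).re = -z.re * t := by simp
    rw [this]
    gcongr; exact hbd t ht
  have hbi : ∀ c : ℝ, IntegrableOn (fun t => M * Real.exp (-z.re * t)) (Ioi c) := fun c =>
    (integrableOn_exp_mul_Ioi (by linarith) c).const_mul M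
  have hi : IntegrableOn (fun t : ℝ => a t * exp (-z * t)) (Ioi 0) := by
    refine Integrable.mono' (hbi 0) (ha.mul (by fun_prop)).aestronglyMeasurable ?_
    filter_upwards [ae_restrict_mem measurableSet_Ioi] with t ht using hb t ht
  have hi2 : IntegrableOn (fun t : ℝ => a t * exp (-z * t)) (Ioi T) :=
    hi.mono_set (Ioi_subset_Ioi hT)
  have := intervalIntegral.integral_interval_add_Ioi hi hi2
  rw [← this, sub_add_cancel_left, norm_neg]
  calc _ ≤ ∫ t in Ioi T, M * Real.exp (-z.re * t) := by
        refine norm_integral_le_of_norm_le (hbi T) ?_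
        filter_upwards [ae_restrict_mem measurableSet_Ioi] with t ht using hb t (hT.trans_lt ht)
    _ = _ := by
        rw [integral_const_mul, integral_exp_mul_Ioi (by linarith)]
        rw [neg_div_neg_eq, mul_div_assoc]

lemma aux_left (a : ℝ → ℂ) (M : ℝ)
    (hbd : ∀ t : ℝ, 0 < t → ‖a t‖ ≤ M) (T : ℝ) (hT : 0 ≤ T) (z : ℂ) (hz : z.re < 0) :
    ‖∫ t in (0:ℝ)..T, a t * exp (-z * t)‖ ≤ M * Real.exp (-z.re * T) / (-z.re) := by
  have hM : 0 ≤ M := (norm_nonneg _).trans (hbd 1 one_pos)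
  have hb : ∀ t : ℝ, 0 < t → ‖a t * exp (-z * t)‖ ≤ M * Real.exp (-z.re * t) := by
    intro t ht
    rw [norm_mul, norm_exp]
    have : (-z * t).re = -z.re * t := by simp
    rw [this]
    gcongr; exact hbd t ht
  calc _ ≤ ∫ t in (0:ℝ)..T, M * Real.exp (-z.re * t) := by
        refine intervalIntegral.norm_integral_le_of_norm_le hT ?_ ?_
        · exact Eventually.of_forall fun t ht => hb t ht.1
        · exact Continuous.intervalIntegrable (by fun_prop) _ _
    _ = M * ((-z.re)⁻¹ * (Real.exp (-z.re * T) - 1)) := by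
        rw [intervalIntegral.integral_const_mul, intervalIntegral.integral_comp_mul_left
          (fun x => Real.exp x) (by linarith : -z.re ≠ 0)]
        simp
    _ ≤ M * ((-z.re)⁻¹ * Real.exp (-z.re * T)) := by
        have : 0 ≤ (-z.re)⁻¹ := inv_nonneg.2 (by linarith)
        gcongr; linarith
    _ = _ := by rw [div_eq_mul_inv]; ring

lemma aux_kernel (R : ℝ) (hR : 0 < R) (θ : ℝ) (T : ℝ) :
    ‖exp (circleMap 0 R θ * T) * (1 + (circleMap 0 R θ)^2 / R^2)‖
      = Real.exp (R * Real.cos θ * T) * (2 * |Real.cos θ|) := by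
  have hR' : (R:ℂ) ≠ 0 := by exact_mod_cast hR.ne'
  have h1 : 1 + (circleMap 0 R θ)^2 / R^2 = exp (θ * I) * (2 * cos θ) := by
    rw [two_cos, mul_add, ← Complex.exp_add, ← Complex.exp_add]
    have : circleMap 0 R θ = R * exp (θ * I) := by simp [circleMap]
    rw [this, mul_pow, mul_div_cancel_left₀ _ (pow_ne_zero 2 hR'), ← Complex.exp_nat_mul, add_comm]
    congr 1
    · congr 1; push_cast; ring
    · rw [show (θ:ℂ) * I + -θ * I = 0 by ring, Complex.exp_zero]
  rw [norm_mul, h1, norm_exp, norm_mul, norm_exp_ofReal_mul_I, one_mul, norm_mul, ← ofReal_cos,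
    norm_real, Real.norm_eq_abs]
  congr 2
  · simp [circleMap, exp_ofReal_mul_I_re]
  · simp

open scoped Topology Real FourierTransform in
lemma aux_RL (φ : ℝ → ℂ) (R : ℝ) (hR : 0 < R) :
    Tendsto (fun T : ℝ => ∫ y in (-R)..R, φ y * exp (y * I * T)) atTop (𝓝 0) := by
  have h := Real.tendsto_integral_exp_smul_cocompact (indicator (Ioc (-R) R) φ)
  have h2 : Tendsto (fun T : ℝ => T * (-(2 * π)⁻¹)) atTop (cocompact ℝ) := by
    refine Tendsto.mono_right ?_ atBot_le_cocompact
    exact tendsto_id.atTop_mul_const_of_neg (by have := Real.pi_pos; simp; positivity)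
  refine (h.comp h2).congr fun T => ?_
  simp only [Function.comp]
  rw [intervalIntegral.integral_of_le (by linarith), ← integral_indicator measurableSet_Ioc]
  congr 1; ext y
  by_cases hy : y ∈ Ioc (-R) R
  · rw [indicator_of_mem hy, indicator_of_mem hy, Circle.smul_def, Real.fourierChar_apply, smul_eq_mul,
      mul_comm]
    congr 2
    have : (π : ℂ) ≠ 0 := by exact_mod_cast Real.pi_ne_zero
    push_cast
    field_simp
  · rw [indicator_of_notMem hy, indicator_of_notMem hy, smul_zero]

open scoped Topology Real in
lemma aux_leftK (R : ℝ) (hR : 0 < R) :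
    Tendsto (fun T : ℝ => ∫ θ in (π/2)..(3*π/2),
      exp (circleMap 0 R θ * T) * (1 + (circleMap 0 R θ)^2 / R^2)) atTop (𝓝 0) := by
  have hcos : ∀ θ ∈ Ioc (π/2) (3*π/2), Real.cos θ ≤ 0 := fun θ hθ =>
    Real.cos_nonpos_of_pi_div_two_le_of_le hθ.1.le (by linarith [hθ.2])
  suffices h : Tendsto (fun T : ℝ => ∫ θ in (π/2)..(3*π/2),
      exp (circleMap 0 R θ * T) * (1 + (circleMap 0 R θ)^2 / R^2)) atTop
      (𝓝 (∫ θ in (π/2)..(3*π/2), (0:ℂ))) by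
    simpa only [intervalIntegral.integral_zero] using h
  refine intervalIntegral.tendsto_integral_filter_of_dominated_convergence (fun _ => 2) ?_ ?_ ?_ ?_
  · refine Eventually.of_forall fun T => Continuous.aestronglyMeasurable ?_
    have := continuous_circleMap 0 R
    fun_prop
  · filter_upwards [eventually_ge_atTop 0] with T hT
    refine Eventually.of_forall fun θ hθ => ?_
    rw [uIoc_of_le (by linarith [Real.pi_pos])] at hθ
    rw [aux_kernel R hR]
    have h1 : Real.exp (R * Real.cos θ * T) ≤ 1 := by
      rw [Real.exp_le_one_iff]
      exact mul_nonpos_of_nonpos_of_nonneg (mul_nonpos_of_nonneg_of_nonpos hR.le (hcos θ hθ)) hT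
    have h2 := Real.abs_cos_le_one θ
    calc Real.exp (R * Real.cos θ * T) * (2 * |Real.cos θ|) ≤ 1 * (2 * 1) := by gcongr
      _ = 2 := by norm_num
  · exact intervalIntegrable_const
  · refine Eventually.of_forall fun θ hθ => ?_
    rw [uIoc_of_le (by linarith [Real.pi_pos])] at hθ
    rw [tendsto_zero_iff_norm_tendsto_zero]
    simp only [aux_kernel R hR]
    rcases (hcos θ hθ).lt_or_eq with h | h
    · have h3 : Tendsto (fun T : ℝ => Real.exp (R * Real.cos θ * T)) atTop (𝓝 0) :=
        Real.tendsto_exp_atBot.comp (tendsto_id.const_mul_atTop_of_neg (mul_neg_of_pos_of_neg hR h))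
      simpa using h3.mul_const (2 * |Real.cos θ|)
    · simp [h]

open scoped Topology Real in
lemma aux_main (a : ℝ → ℂ) (M B : ℝ) (ha : Measurable a)
    (hbd : ∀ t : ℝ, 0 < t → ‖a t‖ ≤ M)
    (F : ℂ → ℂ) (U : Set ℂ) (hU : IsOpen U)
    (hseg : {z : ℂ | z.re = 0 ∧ |z.im| < B} ⊆ U)
    (hF : DifferentiableOn ℂ F (U ∪ {z : ℂ | 0 < z.re}))
    (hFeq : ∀ z : ℂ, 0 < z.re →
      F z = ∫ t in Ioi (0 : ℝ), a t * Complex.exp (-z * t))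
    (R : ℝ) (hR : 0 < R) (hRB : R < B) :
    ∃ e : ℝ → ℝ, Tendsto e atTop (𝓝 0) ∧ ∀ T : ℝ, 0 ≤ T →
      ‖(∫ t in (0 : ℝ)..T, a t) - F 0‖ ≤ 2 * M / R + e T := by
  have hM : 0 ≤ M := (norm_nonneg _).trans (hbd 1 one_pos)
  have hpi := Real.pi_pos
  have hR' : (R:ℂ) ≠ 0 := by exact_mod_cast hR.ne'
  set V := U ∪ {z : ℂ | 0 < z.re} with hV
  have hVo : IsOpen V := hU.union (isOpen_lt continuous_const continuous_re)
  have h0V : (0:ℂ) ∈ V := Or.inl (hseg (by simp; linarith))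
  have hDV : {z : ℂ | 0 ≤ z.re ∧ ‖z‖ ≤ R} ⊆ V := by
    rintro z ⟨h1, h2⟩
    rcases h1.lt_or_eq with h | h
    · exact Or.inr h
    · exact Or.inl (hseg ⟨h.symm, ((abs_im_le_norm z).trans h2).trans_lt hRB⟩)
  have hG : DifferentiableOn ℂ (dslope F 0) V :=
    (differentiableOn_dslope (hVo.mem_nhds h0V)).2 hF
  set E : ℝ → ℂ → ℂ := fun T z => exp (z * T) * (1 + z^2 / R^2) with hE
  have hEd : ∀ T, Differentiable ℂ (E T) := fun T => by simp only [hE]; fun_prop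
  set c : ℝ → ℂ := circleMap 0 R with hc
  have hcc : Continuous c := continuous_circleMap 0 R
  have hcre : ∀ θ, (c θ).re = R * Real.cos θ := fun θ => by
    simp [hc, circleMap, exp_ofReal_mul_I_re]
  have hcn : ∀ θ, ‖c θ‖ = R := fun θ => by simp [hc, abs_of_pos hR]
  set S : ℝ → ℂ → ℂ := fun T z => ∫ t in (0:ℝ)..T, a t * exp (-z * t) with hS
  -- error terms
  set e1 : ℝ → ℂ := fun T => ∫ y in (-R)..R,
    (dslope F 0 (y * I) * (1 + (y * I)^2 / R^2)) * exp (y * I * T) with he1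
  set e2 : ℝ → ℂ := fun T => ∫ θ in (π/2)..(3*π/2), E T (c θ) with he2
  have he1t : Tendsto e1 atTop (𝓝 0) := aux_RL _ R hR
  have he2t : Tendsto e2 atTop (𝓝 0) := aux_leftK R hR
  refine ⟨fun T => (‖e1 T‖ + ‖F 0‖ * ‖e2 T‖) / (2 * π), ?_, ?_⟩
  · have := (he1t.norm.add (he2t.norm.const_mul ‖F 0‖)).div_const (2 * π)
    simpa using this
  intro T hT
  have hSd : Differentiable ℂ (S T) := aux_entire a M ha hbd T hT
  have hS0 : S T 0 = ∫ t in (0 : ℝ)..T, a t := by simp [hS]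
  have hcir : ∫ θ in (-(π/2))..(3*π/2), (S T (c θ) - F 0) * E T (c θ) = 2 * π * (S T 0 - F 0) := by
    have hd : Differentiable ℂ (fun z => (S T z - F 0) * E T z) :=
      (hSd.sub_const _).mul (hEd T)
    have h := (hd.diffContOnCl (s := Metric.ball 0 |R|)).circleAverage
    rw [Real.circleAverage_def] at h
    have hper : Function.Periodic (fun θ => (S T (c θ) - F 0) * E T (c θ)) (2 * π) := by
      intro θ
      simp only [hc, periodic_circleMap 0 R θ]
    have h3 := hper.intervalIntegral_add_eq 0 (-(π/2))
    rw [zero_add, show -(π/2) + 2 * π = 3*π/2 by ring] at h3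
    rw [← h3]
    have hE0 : E T 0 = 1 := by simp [hE]
    rw [hE0, mul_one] at h
    rw [← h, real_smul]
    have : (π:ℂ) ≠ 0 := by exact_mod_cast hpi.ne'
    push_cast
    field_simp
    rfl
  have hcont1 : Continuous (fun θ => (S T (c θ) - F 0) * E T (c θ)) :=
    ((hSd.continuous.comp hcc).sub continuous_const).mul ((hEd T).continuous.comp hcc)
  have hcont2 : Continuous (fun θ => S T (c θ) * E T (c θ)) :=
    (hSd.continuous.comp hcc).mul ((hEd T).continuous.comp hcc)
  have hcont3 : Continuous (fun θ => F 0 * E T (c θ)) :=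
    continuous_const.mul ((hEd T).continuous.comp hcc)
  have hmem : ∀ θ ∈ Icc (-(π/2)) (π/2), c θ ∈ {z : ℂ | 0 ≤ z.re ∧ ‖z‖ ≤ R} := fun θ hθ =>
    ⟨by rw [hcre]; exact mul_nonneg hR.le (Real.cos_nonneg_of_mem_Icc hθ), (hcn θ).le⟩
  have hFc : ContinuousOn (fun θ => F (c θ)) (Icc (-(π/2)) (π/2)) :=
    hF.continuousOn.comp hcc.continuousOn (fun θ hθ => hDV (hmem θ hθ))
  have hle : -(π/2) ≤ π/2 := by linarith
  have hi1 : IntervalIntegrable (fun θ => (S T (c θ) - F (c θ)) * E T (c θ)) volume (-(π/2)) (π/2) := by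
    apply ContinuousOn.intervalIntegrable
    rw [uIcc_of_le hle]
    exact ((hSd.continuous.comp hcc).continuousOn.sub hFc).mul
      ((hEd T).continuous.comp hcc).continuousOn
  have hi2 : IntervalIntegrable (fun θ => (F (c θ) - F 0) * E T (c θ)) volume (-(π/2)) (π/2) := by
    apply ContinuousOn.intervalIntegrable
    rw [uIcc_of_le hle]
    exact (hFc.sub continuousOn_const).mul ((hEd T).continuous.comp hcc).continuousOn
  have hsplit : 2 * π * (S T 0 - F 0) =
      (∫ θ in (-(π/2))..(π/2), (S T (c θ) - F (c θ)) * E T (c θ))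
      + (∫ θ in (-(π/2))..(π/2), (F (c θ) - F 0) * E T (c θ))
      + ((∫ θ in (π/2)..(3*π/2), S T (c θ) * E T (c θ)) - F 0 * e2 T) := by
    rw [← hcir, ← intervalIntegral.integral_add_adjacent_intervals
      (hcont1.intervalIntegrable _ (π/2)) (hcont1.intervalIntegrable _ _),
      ← intervalIntegral.integral_add hi1 hi2]
    congr 1
    · congr 1; ext θ; ring
    · rw [he2, ← intervalIntegral.integral_const_mul, ← intervalIntegral.integral_sub
        (hcont2.intervalIntegrable _ _) (hcont3.intervalIntegrable _ _)]
      congr 1; ext θ; ring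
  have hmid : (∫ θ in (-(π/2))..(π/2), (F (c θ) - F 0) * E T (c θ)) = e1 T := by
    have h := aux_halfdisc (fun z => dslope F 0 z * E T z) R hR
      ((hG.mono hDV).mul (hEd T).differentiableOn)
    have hl : (∫ θ in (-(π/2))..(π/2), (F (c θ) - F 0) * E T (c θ))
        = ∫ θ in (-(π/2))..(π/2), (dslope F 0 (circleMap 0 R θ) * E T (circleMap 0 R θ)) *
          circleMap 0 R θ := by
      congr 1; ext θ
      have hs := sub_smul_dslope F 0 (c θ)
      rw [sub_zero, smul_eq_mul] at hs
      rw [← hs, hc]; ring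
    rw [hl, h, he1]
    congr 1; ext y; simp only [hE]; ring
  have hk : ∀ θ, ‖E T (c θ)‖ = Real.exp (R * Real.cos θ * T) * (2 * |Real.cos θ|) :=
    fun θ => aux_kernel R hR θ T
  have hb1 : ‖∫ θ in (-(π/2))..(π/2), (S T (c θ) - F (c θ)) * E T (c θ)‖
      ≤ (2 * M / R) * |π/2 - -(π/2)| := by
    apply intervalIntegral.norm_integral_le_of_norm_le_const
    intro θ hθ
    rw [uIoc_of_le hle] at hθ
    rw [norm_mul, hk]
    rcases (Real.cos_nonneg_of_mem_Icc ⟨hθ.1.le, hθ.2⟩).lt_or_eq with h | h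
    · have hz : 0 < (c θ).re := by rw [hcre]; positivity
      have hr := aux_right a M ha hbd T hT (c θ) hz
      rw [← hFeq _ hz, hcre] at hr
      calc _ ≤ (M * Real.exp (-(R * Real.cos θ) * T) / (R * Real.cos θ)) *
            (Real.exp (R * Real.cos θ * T) * (2 * |Real.cos θ|)) := by gcongr
        _ = 2 * M / R := by
            rw [abs_of_pos h, neg_mul, Real.exp_neg]
            have := (Real.exp_pos (R * Real.cos θ * T)).ne'
            field_simp
    · rw [← h]; simp; positivity
  have hb2 : ‖∫ θ in (π/2)..(3*π/2), S T (c θ) * E T (c θ)‖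
      ≤ (2 * M / R) * |3*π/2 - π/2| := by
    apply intervalIntegral.norm_integral_le_of_norm_le_const
    intro θ hθ
    rw [uIoc_of_le (by linarith)] at hθ
    rw [norm_mul, hk]
    rcases (Real.cos_nonpos_of_pi_div_two_le_of_le hθ.1.le (by linarith [hθ.2] : θ ≤ π + π/2)).lt_or_eq
      with h | h
    · have hz : (c θ).re < 0 := by rw [hcre]; exact mul_neg_of_pos_of_neg hR h
      have hr := aux_left a M hbd T hT (c θ) hz
      rw [hcre] at hr
      calc _ ≤ (M * Real.exp (-(R * Real.cos θ) * T) / (-(R * Real.cos θ))) *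
            (Real.exp (R * Real.cos θ * T) * (2 * |Real.cos θ|)) := by gcongr
        _ = 2 * M / R := by
            rw [abs_of_neg h, neg_mul, Real.exp_neg]
            have := (Real.exp_pos (R * Real.cos θ * T)).ne'
            have := h.ne
            field_simp
    · rw [h]; simp; positivity
  rw [show π/2 - -(π/2) = π by ring, abs_of_pos hpi] at hb1
  rw [show 3*π/2 - π/2 = π by ring, abs_of_pos hpi] at hb2
  rw [hmid] at hsplit
  have hn : 2 * π * ‖S T 0 - F 0‖ ≤ (2 * M / R) * π + ‖e1 T‖ + ((2 * M / R) * π + ‖F 0‖ * ‖e2 T‖) := by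
    have h1 : ‖(2 * π * (S T 0 - F 0) : ℂ)‖ = 2 * π * ‖S T 0 - F 0‖ := by
      rw [norm_mul, norm_mul, norm_real, Real.norm_eq_abs, abs_of_pos hpi]; simp
    rw [← h1, hsplit]
    refine (norm_add_le _ _).trans ?_
    refine add_le_add ((norm_add_le _ _).trans (by gcongr)) ((norm_sub_le _ _).trans ?_)
    rw [norm_mul]
    gcongr
  rw [← hS0]
  have : ‖S T 0 - F 0‖ ≤ ((2 * M / R) * π + ‖e1 T‖ + ((2 * M / R) * π + ‖F 0‖ * ‖e2 T‖)) / (2 * π) := by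
    rw [le_div_iff₀ (by positivity)]; linarith
  refine this.trans (le_of_eq ?_)
  field_simp
  ring

/-- Theorem 1.1: if the Laplace transform of the bounded function `a` extends
analytically to (a neighborhood of) the open segment `(-iB, iB)`, then
`limsup_{T→∞} |∫₀ᵀ a(t) dt - f(0)| ≤ 2M/B`. -/
theorem stmt_5 (a : ℝ → ℂ) (M B : ℝ) (hB : 0 < B) (ha : Measurable a)
    (hbd : ∀ t : ℝ, 0 < t → ‖a t‖ ≤ M)
    (F : ℂ → ℂ) (U : Set ℂ) (hU : IsOpen U)
    (hseg : {z : ℂ | z.re = 0 ∧ |z.im| < B} ⊆ U)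
    (hF : DifferentiableOn ℂ F (U ∪ {z : ℂ | 0 < z.re}))
    (hFeq : ∀ z : ℂ, 0 < z.re →
      F z = ∫ t in Ioi (0 : ℝ), a t * Complex.exp (-z * t)) :
    limsup (fun T : ℝ => ‖(∫ t in (0 : ℝ)..T, a t) - F 0‖) atTop ≤ 2 * M / B := by
  have key : ∀ R : ℝ, 0 < R → R < B →
      limsup (fun T : ℝ => ‖(∫ t in (0 : ℝ)..T, a t) - F 0‖) atTop ≤ 2 * M / R := by
    intro R hR hRB
    obtain ⟨e, he, hb⟩ := aux_main a M B ha hbd F U hU hseg hF hFeq R hR hRB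
    refine le_of_forall_pos_le_add fun ε hε => ?_
    refine limsup_le_of_le ?_ ?_
    · exact isCoboundedUnder_le_of_le atTop (x := 0) (fun T => norm_nonneg _)
    · filter_upwards [eventually_ge_atTop 0, he.eventually (gt_mem_nhds hε)] with T hT hlt
      linarith [hb T hT]
  have ht : Tendsto (fun R : ℝ => 2 * M / R) (nhdsWithin B (Iio B)) (nhds (2 * M / B)) :=
    (tendsto_const_nhds.div tendsto_id hB.ne').mono_left nhdsWithin_le_nhds
  refine ge_of_tendsto ht ?_
  filter_upwards [Ioo_mem_nhdsLT hB] with R hR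
  exact key R hR.1 hR.2
end

section
/- Let a : [0,∞) → ℂ be measurable and bounded, and suppose the Laplace transform f(z) = ∫₀^∞ a(t)e^{-zt} dt extends analytically to every point of the imaginary axis. Then the improper integral ∫₀^{∞-} a(t) dt = lim_{T→∞} ∫₀^T a(t) dt exists and equals f(0). -/
open MeasureTheory Complex Set Filter

lemma exists_kernel : ∃ φ K : ℝ → ℂ, Continuous φ ∧ HasCompactSupport φ ∧ Continuous K ∧
    (∀ s : ℝ, K s = ∫ y : ℝ, cexp (2 * Real.pi * I * y * s) * φ y) ∧
    Integrable K ∧ Integrable (fun s : ℝ => |s| * ‖K s‖) ∧ ∫ s, K s = 1 := by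
  let b : ContDiffBump (0 : ℝ) := ⟨1, 2, by norm_num, by norm_num⟩
  let φ : ℝ → ℂ := fun x => (b x : ℂ)
  have hφs : HasCompactSupport φ := b.hasCompactSupport.comp_left (g := fun x : ℝ => (x : ℂ)) (by simp)
  have hφd : ContDiff ℝ (⊤ : ℕ∞) φ := Complex.ofRealCLM.contDiff.comp (b.contDiff)
  let S : SchwartzMap ℝ ℂ := hφs.toSchwartzMap hφd
  let K : SchwartzMap ℝ ℂ := FourierTransformInv.fourierInv S
  refine ⟨φ, K, hφd.continuous, hφs, K.continuous, ?_, K.integrable, ?_, ?_⟩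
  · intro s
    have : (K : ℝ → ℂ) = FourierTransformInv.fourierInv φ := SchwartzMap.fourierInv_coe S
    rw [this, Real.fourierInv_eq']
    congr 1
    ext y
    simp
    left
    congr 1
    ring
  · simpa using K.integrable_pow_mul volume 1
  · have h1 : FourierTransform.fourier K = S := by simp [K]
    have h2 : (FourierTransform.fourier K : SchwartzMap ℝ ℂ) 0 = 1 := by
      rw [h1]
      change ((b 0 : ℝ) : ℂ) = 1
      rw [b.one_of_mem_closedBall (by simpa using b.rIn_pos.le)]; simp
    have h3 : (FourierTransform.fourier K : SchwartzMap ℝ ℂ) 0 = ∫ s, K s := by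
      rw [SchwartzMap.fourier_coe, Real.fourier_eq']
      simp
    rw [← h3, h2]

lemma laplace_primitive (a : ℝ → ℂ) (M : ℝ) (ha : Measurable a)
    (hbd : ∀ t : ℝ, 0 < t → ‖a t‖ ≤ M) (z : ℂ) (hz : 0 < z.re) :
    ∫ t in Ioi (0 : ℝ), (∫ u in (0 : ℝ)..t, a u) * cexp (-z * t) =
      (∫ t in Ioi (0 : ℝ), a t * cexp (-z * t)) / z := by
  have hM : 0 ≤ M := (norm_nonneg _).trans (hbd 1 one_pos)
  have hz0 : z ≠ 0 := by rintro rfl; simp at hz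
  let f : ℝ → ℝ → ℂ := fun u t => if u < t then a u * cexp (-z * t) else 0
  have hfm : Measurable (Function.uncurry f) := by
    refine Measurable.ite (measurableSet_lt measurable_fst measurable_snd) ?_ measurable_const
    fun_prop
  have he : Integrable (fun t : ℝ => Real.exp (-(z.re / 2) * t)) (volume.restrict (Ioi 0)) :=
    exp_neg_integrableOn_Ioi 0 (by positivity)
  have hfi : Integrable (Function.uncurry f)
      ((volume.restrict (Ioi (0 : ℝ))).prod (volume.restrict (Ioi (0 : ℝ)))) := by
    refine ((he.mul_prod he).const_mul M).mono' hfm.aestronglyMeasurable ?_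
    rw [Measure.prod_restrict]
    filter_upwards [ae_restrict_mem (measurableSet_Ioi.prod measurableSet_Ioi)] with p hp
    obtain ⟨h1, h2⟩ := hp
    simp only [Function.uncurry, f]
    have h1' : 0 < p.1 := h1
    split_ifs with h
    · rw [norm_mul, Complex.norm_exp, ← Real.exp_add]
      refine mul_le_mul (hbd _ h1) (Real.exp_le_exp.2 ?_) (Real.exp_pos _).le hM
      simp
      nlinarith
    · simp; positivity
  have hswap := integral_integral_swap hfi
  have hL : ∫ u in Ioi (0:ℝ), ∫ t in Ioi (0:ℝ), f u t
      = (∫ t in Ioi (0 : ℝ), a t * cexp (-z * t)) / z := by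
    rw [← integral_div]
    refine setIntegral_congr_fun measurableSet_Ioi fun u hu => ?_
    have hu' : 0 < u := hu
    have e : ∀ t, f u t = (Ioi u).indicator (fun t : ℝ => a u * cexp (-z * t)) t := fun t => by
      simp [f, indicator]
    simp only [e]
    rw [setIntegral_indicator measurableSet_Ioi, Ioi_inter_Ioi, sup_eq_right.2 hu'.le,
      integral_const_mul, integral_exp_mul_complex_Ioi (by simpa using hz)]
    field_simp
  have hR : ∫ t in Ioi (0:ℝ), ∫ u in Ioi (0:ℝ), f u t
      = ∫ t in Ioi (0 : ℝ), (∫ u in (0 : ℝ)..t, a u) * cexp (-z * t) := by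
    refine setIntegral_congr_fun measurableSet_Ioi fun t ht => ?_
    have ht' : 0 < t := ht
    have e : ∀ u, f u t = (Iio t).indicator (fun u : ℝ => a u * cexp (-z * t)) u := fun t => by
      simp [f, indicator]
    simp only [e]
    rw [setIntegral_indicator measurableSet_Iio, Ioi_inter_Iio, integral_mul_const,
      intervalIntegral.integral_of_le ht'.le, integral_Ioc_eq_integral_Ioo]
  rw [← hR, ← hL, hswap]

lemma decay_bound (B : ℝ → ℂ) (M c : ℝ) (hM : 0 ≤ M) (hc : 0 ≤ c)
    (hB : ∀ t, 0 < t → ‖B t‖ ≤ M * t + c) (ε : ℝ) (hε : 0 < ε) (t : ℝ) (ht : 0 < t) :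
    ‖B t‖ * Real.exp (-ε * t) ≤ (2 * M / ε + c) * Real.exp (-(ε / 2) * t) := by
  have h1 : Real.exp (-ε * t) = Real.exp (-(ε / 2) * t) * Real.exp (-(ε / 2) * t) := by
    rw [← Real.exp_add]; ring_nf
  have h2 : Real.exp (-(ε / 2) * t) ≤ 1 := Real.exp_le_one_iff.2 (by nlinarith)
  have h3 : t * Real.exp (-(ε / 2) * t) ≤ 2 / ε := by
    have h4 := Real.add_one_le_exp (ε / 2 * t)
    have h5 : Real.exp (ε / 2 * t) * Real.exp (-(ε / 2) * t) = 1 := by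
      rw [← Real.exp_add]; simp
    have h6 := Real.exp_pos (-(ε / 2) * t)
    rw [le_div_iff₀ hε]
    nlinarith
  have h6 := Real.exp_pos (-(ε / 2) * t)
  rw [h1, ← mul_assoc]
  gcongr
  calc ‖B t‖ * Real.exp (-(ε / 2) * t) ≤ (M * t + c) * Real.exp (-(ε / 2) * t) := by
        gcongr; exact hB t ht
    _ = M * (t * Real.exp (-(ε / 2) * t)) + c * Real.exp (-(ε / 2) * t) := by ring
    _ ≤ M * (2 / ε) + c * 1 := by gcongr
    _ = _ := by ring

lemma integrable_decay (B : ℝ → ℂ) (hBc : Continuous B) (M c : ℝ) (hM : 0 ≤ M) (hc : 0 ≤ c)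
    (hB : ∀ t, 0 < t → ‖B t‖ ≤ M * t + c) (z : ℂ) (hz : 0 < z.re) :
    IntegrableOn (fun t : ℝ => B t * cexp (-z * t)) (Ioi 0) := by
  refine Integrable.mono' ((exp_neg_integrableOn_Ioi 0 (half_pos hz)).const_mul (2 * M / z.re + c))
    (by fun_prop) ?_
  filter_upwards [ae_restrict_mem measurableSet_Ioi] with t ht
  rw [norm_mul, Complex.norm_exp]
  simpa using decay_bound B M c hM hc hB z.re hz t ht

lemma swap_kernel (φ K : ℝ → ℂ) (hφ : Continuous φ) (hφs : HasCompactSupport φ)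
    (hK : ∀ s : ℝ, K s = ∫ y : ℝ, cexp (2 * Real.pi * I * y * s) * φ y)
    (B : ℝ → ℂ) (hBc : Continuous B) (M c : ℝ) (hM : 0 ≤ M) (hc : 0 ≤ c)
    (hB : ∀ t, 0 < t → ‖B t‖ ≤ M * t + c) (ε : ℝ) (hε : 0 < ε) (T : ℝ) :
    ∫ t in Ioi (0:ℝ), B t * cexp (-(ε : ℂ) * t) * K (T - t) =
      ∫ y : ℝ, cexp (2 * Real.pi * I * y * T) * φ y *
        ∫ t in Ioi (0:ℝ), B t * cexp (-(ε + 2 * Real.pi * I * y) * t) := by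
  have hi := integrable_decay B hBc M c hM hc hB ε (by simpa using hε)
  have hp := hi.mul_prod (hφ.integrable_of_hasCompactSupport hφs (μ := volume))
  have hp2 : Integrable (Function.uncurry fun (t y : ℝ) =>
      cexp (2 * Real.pi * I * y * (T - t)) * (B t * cexp (-(ε : ℂ) * t) * φ y))
      ((volume.restrict (Ioi (0 : ℝ))).prod volume) := by
    refine Integrable.bdd_mul (c := 1) hp ?_ ?_
    · apply Continuous.aestronglyMeasurable; fun_prop
    · refine Eventually.of_forall fun p => ?_
      rw [Complex.norm_exp]
      simp
  have h := integral_integral_swap hp2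
  have hL : ∀ t : ℝ, B t * cexp (-(ε : ℂ) * t) * K (T - t) =
      ∫ y : ℝ, cexp (2 * Real.pi * I * y * (T - t)) * (B t * cexp (-(ε : ℂ) * t) * φ y) := by
    intro t
    rw [hK, ← integral_const_mul]
    congr 1; ext y
    push_cast; ring
  have hR : ∀ y : ℝ, cexp (2 * Real.pi * I * y * T) * φ y *
        ∫ t in Ioi (0:ℝ), B t * cexp (-(ε + 2 * Real.pi * I * y) * t) =
      ∫ t in Ioi (0:ℝ), cexp (2 * Real.pi * I * y * (T - t)) * (B t * cexp (-(ε : ℂ) * t) * φ y) := by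
    intro y
    rw [← integral_const_mul]
    congr 1; ext t
    have : cexp (-(ε + 2 * Real.pi * I * y) * t) =
      cexp (-(ε : ℂ) * t) * cexp (-(2 * Real.pi * I * y) * t) := by
      rw [← Complex.exp_add]; ring_nf
    rw [this]
    have : cexp (2 * Real.pi * I * y * (T - t)) =
      cexp (2 * Real.pi * I * y * T) * cexp (-(2 * Real.pi * I * y) * t) := by
      rw [← Complex.exp_add]; ring_nf
    rw [this]; ring
  simp only [hL, hR]
  exact h

lemma integrable_growth (K : ℝ → ℂ) (hKc : Continuous K) (hKi : Integrable K)
    (hKs : Integrable (fun s : ℝ => |s| * ‖K s‖)) (M c T : ℝ) :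
    Integrable (fun t : ℝ => (M * |t| + c) * ‖K (T - t)‖) := by
  have h1 : Integrable (fun t : ℝ => ‖K (T - t)‖) := (hKi.comp_sub_left T).norm
  have h2 : Integrable (fun t : ℝ => |T - t| * ‖K (T - t)‖) := hKs.comp_sub_left T
  have h3 : Integrable (fun t : ℝ => |t| * ‖K (T - t)‖) := by
    refine ((h1.const_mul |T|).add h2).mono' (by fun_prop) ?_
    refine Eventually.of_forall fun t => ?_
    rw [Real.norm_eq_abs, abs_of_nonneg (by positivity), Pi.add_apply, ← add_mul]
    gcongr
    have := abs_sub T (T - t)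
    simpa using this
  refine ((h3.const_mul M).add (h1.const_mul c)).congr (Eventually.of_forall fun t => ?_)
  simp only [Pi.add_apply]; ring

lemma limit_identity (φ K : ℝ → ℂ) (hφ : Continuous φ) (hφs : HasCompactSupport φ)
    (hKc : Continuous K)
    (hK : ∀ s : ℝ, K s = ∫ y : ℝ, cexp (2 * Real.pi * I * y * s) * φ y)
    (hKi : Integrable K) (hKs : Integrable (fun s : ℝ => |s| * ‖K s‖))
    (B : ℝ → ℂ) (hBc : Continuous B) (M c : ℝ) (hM : 0 ≤ M) (hc : 0 ≤ c)
    (hB : ∀ t, 0 < t → ‖B t‖ ≤ M * t + c)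
    (H : ℂ → ℂ) (hH : ContinuousOn H {z | 0 ≤ z.re})
    (hHB : ∀ z : ℂ, 0 < z.re → H z = ∫ t in Ioi (0:ℝ), B t * cexp (-z * t)) (T : ℝ) :
    ∫ t in Ioi (0:ℝ), B t * K (T - t) =
      ∫ y : ℝ, cexp (2 * Real.pi * I * y * T) * φ y * H (2 * Real.pi * I * y) := by
  have hL : Tendsto (fun ε : ℝ => ∫ t in Ioi (0:ℝ), B t * cexp (-(ε : ℂ) * t) * K (T - t))
      (nhdsWithin 0 (Ioi 0)) (nhds (∫ t in Ioi (0:ℝ), B t * K (T - t))) := by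
    refine tendsto_integral_filter_of_dominated_convergence
      (fun t : ℝ => (M * |t| + c) * ‖K (T - t)‖) ?_ ?_
      (integrable_growth K hKc hKi hKs M c T).integrableOn ?_
    · exact Eventually.of_forall fun ε => by fun_prop
    · filter_upwards [self_mem_nhdsWithin] with ε hε
      have hε : 0 < ε := hε
      filter_upwards [ae_restrict_mem measurableSet_Ioi] with t ht
      have ht : 0 < t := ht
      rw [norm_mul, norm_mul]
      gcongr
      have : ‖cexp (-(ε : ℂ) * t)‖ ≤ 1 := by
        rw [Complex.norm_exp, Real.exp_le_one_iff]; simp; positivity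
      calc _ ≤ (M * t + c) * 1 := by gcongr; exact hB t ht
        _ = _ := by rw [abs_of_pos ht, mul_one]
    · refine Eventually.of_forall fun t => ?_
      have : Continuous fun ε : ℝ => B t * cexp (-(ε : ℂ) * t) * K (T - t) := by fun_prop
      simpa using (this.tendsto 0).mono_left nhdsWithin_le_nhds
  have hR : Tendsto (fun ε : ℝ => ∫ y : ℝ, cexp (2 * Real.pi * I * y * T) * φ y *
        H (ε + 2 * Real.pi * I * y)) (nhdsWithin 0 (Ioi 0))
      (nhds (∫ y : ℝ, cexp (2 * Real.pi * I * y * T) * φ y * H (2 * Real.pi * I * y))) := by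
    have hcomp : IsCompact ((fun p : ℝ × ℝ => (p.1 : ℂ) + 2 * Real.pi * I * p.2) ''
        (Icc 0 1 ×ˢ tsupport φ)) := (isCompact_Icc.prod hφs).image (by fun_prop)
    obtain ⟨C, hC⟩ := hcomp.exists_bound_of_continuousOn (f := H) (hH.mono (by
      rintro _ ⟨p, ⟨h1, -⟩, rfl⟩
      simpa using h1.1))
    have hcont : ∀ ε : ℝ, 0 ≤ ε → Continuous fun y : ℝ => H (ε + 2 * Real.pi * I * y) := by
      intro ε hε
      exact hH.comp_continuous (by fun_prop) (fun y => by simpa using hε)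
    refine tendsto_integral_filter_of_dominated_convergence
      (fun y : ℝ => C * ‖φ y‖) ?_ ?_
      ((hφ.integrable_of_hasCompactSupport hφs).norm.const_mul C) ?_
    · filter_upwards [self_mem_nhdsWithin] with ε hε
      have := hcont ε (le_of_lt hε)
      apply Continuous.aestronglyMeasurable
      exact Continuous.mul (by fun_prop) this
    · filter_upwards [Ioc_mem_nhdsGT (zero_lt_one' ℝ)] with ε hε
      refine Eventually.of_forall fun y => ?_
      have h1 : ‖cexp (2 * Real.pi * I * y * T)‖ = 1 := by rw [Complex.norm_exp]; simp
      rw [norm_mul, norm_mul, h1, one_mul, mul_comm]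
      by_cases hy : y ∈ tsupport φ
      · gcongr
        exact hC _ ⟨(ε, y), ⟨⟨hε.1.le, hε.2⟩, hy⟩, rfl⟩
      · simp [image_eq_zero_of_notMem_tsupport hy]
    · refine Eventually.of_forall fun y => ?_
      refine Tendsto.const_mul _ ?_
      have h1 : Tendsto H (nhdsWithin (2 * Real.pi * I * y) {z | 0 ≤ z.re})
        (nhds (H (2 * Real.pi * I * y))) := hH _ (by simp)
      refine h1.comp (tendsto_nhdsWithin_iff.2 ⟨?_, ?_⟩)
      · have : Continuous fun ε : ℝ => (ε : ℂ) + 2 * Real.pi * I * y := by fun_prop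
        simpa using (this.tendsto 0).mono_left nhdsWithin_le_nhds
      · filter_upwards [self_mem_nhdsWithin] with ε hε
        simpa using le_of_lt hε
  refine tendsto_nhds_unique hL (hR.congr' ?_)
  filter_upwards [self_mem_nhdsWithin] with ε hε
  have hε : 0 < ε := hε
  rw [swap_kernel φ K hφ hφs hK B hBc M c hM hc hB ε hε T]
  congr 1; ext y
  rw [hHB _ (by simpa using hε)]

lemma riemann_lebesgue (g : ℝ → ℂ) :
    Tendsto (fun T : ℝ => ∫ y : ℝ, cexp (2 * Real.pi * I * y * T) * g y) atTop (nhds 0) := by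
  have h := (Real.tendsto_integral_exp_smul_cocompact g).comp
    ((tendsto_neg_atTop_atBot (G := ℝ)).mono_right atBot_le_cocompact)
  refine h.congr fun T => ?_
  simp only [Function.comp]
  congr 1; ext y
  rw [Circle.smul_def, Real.fourierChar_apply, smul_eq_mul]
  congr 2
  push_cast; ring

lemma approx_bound : ∃ C : ℝ, 0 ≤ C ∧ ∀ (a : ℝ → ℂ) (M : ℝ) (_ : Measurable a)
    (_ : ∀ t : ℝ, 0 < t → ‖a t‖ ≤ M)
    (F : ℂ → ℂ) (U : Set ℂ) (_ : IsOpen U)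
    (_ : {z : ℂ | z.re = 0} ⊆ U)
    (_ : DifferentiableOn ℂ F (U ∪ {z : ℂ | 0 < z.re}))
    (_ : ∀ z : ℂ, 0 < z.re →
      F z = ∫ t in Ioi (0 : ℝ), a t * Complex.exp (-z * t)) (δ : ℝ) (_ : 0 < δ),
    ∀ᶠ T : ℝ in atTop, ‖(∫ t in (0 : ℝ)..T, a t) - F 0‖ ≤ C * M + δ := by
  obtain ⟨φ, K, hφ, hφs, hKc, hK, hKi, hKs, hK1⟩ := exists_kernel
  refine ⟨∫ s : ℝ, |s| * ‖K s‖, integral_nonneg fun s => by positivity, ?_⟩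
  intro a M ha hbd F U hU haxis hF hFeq δ hδ
  have hM : 0 ≤ M := (norm_nonneg _).trans (hbd 1 one_pos)
  have hint : ∀ x y : ℝ, 0 ≤ x → 0 ≤ y → IntervalIntegrable a volume x y := by
    intro x y hx hy
    refine IntervalIntegrable.mono_fun' (g := fun _ => M) intervalIntegrable_const
      ha.aestronglyMeasurable ?_
    filter_upwards [ae_restrict_mem measurableSet_uIoc] with t ht
    exact hbd t ((le_min hx hy).trans_lt ht.1)
  let B : ℝ → ℂ := fun t => (∫ u in (0:ℝ)..(max t 0), a u) - F 0
  have hlip : ∀ x y, ‖B x - B y‖ ≤ M * |x - y| := by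
    intro x y
    have e : B x - B y = ∫ u in (max y 0)..(max x 0), a u := by
      simp only [B, sub_sub_sub_cancel_right]
      exact intervalIntegral.integral_interval_sub_left (hint _ _ le_rfl (le_max_right _ _))
        (hint _ _ le_rfl (le_max_right _ _))
    rw [e]
    refine (intervalIntegral.norm_integral_le_of_norm_le_const (C := M) ?_).trans ?_
    · intro t ht
      exact hbd t ((le_min (le_max_right _ _) (le_max_right _ _)).trans_lt ht.1)
    · exact mul_le_mul_of_nonneg_left (abs_max_sub_max_le_abs x y 0) hM
  have hBc : Continuous B := by
    refine (LipschitzWith.of_dist_le_mul (K := ⟨M, hM⟩) fun x y => ?_).continuous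
    rw [dist_eq_norm, Real.dist_eq]; exact hlip x y
  have hB0 : ∀ t ≤ 0, B t = - F 0 := fun t ht => by simp [B, max_eq_right ht]
  have hBg' : ∀ t, ‖B t‖ ≤ M * |t| + ‖F 0‖ := by
    intro t
    have h1 := hlip t 0
    rw [hB0 0 le_rfl, sub_zero] at h1
    calc ‖B t‖ = ‖(B t - - F 0) + (- F 0)‖ := by simp
      _ ≤ _ := norm_add_le _ _
      _ ≤ _ := by rw [norm_neg]; gcongr
  have hBg : ∀ t, 0 < t → ‖B t‖ ≤ M * t + ‖F 0‖ := fun t ht => by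
    simpa [abs_of_pos ht] using hBg' t
  have hopen : IsOpen (U ∪ {z : ℂ | 0 < z.re}) :=
    hU.union (isOpen_lt continuous_const Complex.continuous_re)
  have hsub : {z : ℂ | 0 ≤ z.re} ⊆ U ∪ {z : ℂ | 0 < z.re} := by
    intro z hz
    rcases (show 0 ≤ z.re from hz).eq_or_lt with h | h
    · exact Or.inl (haxis h.symm)
    · exact Or.inr h
  have hH : ContinuousOn (dslope F 0) {z | 0 ≤ z.re} := by
    refine ContinuousOn.mono ?_ hsub
    have h0 : U ∪ {z : ℂ | 0 < z.re} ∈ nhds (0:ℂ) := hopen.mem_nhds (hsub (by simp))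
    exact (continuousOn_dslope h0).2 ⟨hF.continuousOn, hF.differentiableAt h0⟩
  have hHB : ∀ z : ℂ, 0 < z.re → dslope F 0 z = ∫ t in Ioi (0:ℝ), B t * cexp (-z * t) := by
    intro z hz
    have hz0 : z ≠ 0 := by rintro rfl; simp at hz
    rw [dslope_of_ne _ hz0, slope_def_field, sub_zero, hFeq z hz]
    have hi := integrable_decay B hBc M ‖F 0‖ hM (norm_nonneg _) hBg z hz
    have hi2 : IntegrableOn (fun t : ℝ => F 0 * cexp (-z * t)) (Ioi 0) :=
      (integrableOn_exp_mul_complex_Ioi (by simpa using hz) 0).const_mul _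
    have e1 := integral_add hi hi2
    have e2 : ∫ t in Ioi (0:ℝ), (B t * cexp (-z * t) + F 0 * cexp (-z * t)) =
        ∫ t in Ioi (0 : ℝ), (∫ u in (0 : ℝ)..t, a u) * cexp (-z * t) := by
      refine setIntegral_congr_fun measurableSet_Ioi fun t ht => ?_
      have ht : 0 < t := ht
      simp only [B, max_eq_left ht.le]; ring
    rw [e2, laplace_primitive a M ha hbd z hz, integral_const_mul,
      integral_exp_mul_complex_Ioi (by simpa using hz)] at e1
    rw [sub_div, e1]
    simp
    field_simp
    ring
  have hlim := riemann_lebesgue (fun y : ℝ => φ y * dslope F 0 (2 * Real.pi * I * y))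
  have hlim1 : Tendsto (fun T : ℝ => ∫ t in Ioi (0:ℝ), B t * K (T - t)) atTop (nhds 0) := by
    refine hlim.congr fun T => ?_
    rw [limit_identity φ K hφ hφs hKc hK hKi hKs B hBc M ‖F 0‖ hM (norm_nonneg _) hBg _ hH hHB T]
    simp only [mul_assoc]
  have hlim2 : Tendsto (fun T : ℝ => ∫ t in Iic (0:ℝ), B t * K (T - t)) atTop (nhds 0) := by
    have h1 : Tendsto (fun T : ℝ => ∫ s in Ici T, K s) atTop (nhds 0) := by
      have := tendsto_setIntegral_of_antitone (μ := volume) (f := K) (s := fun T : ℝ => Ici T)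
        (fun _ => measurableSet_Ici) (fun x y h => Ici_subset_Ici.2 h) ⟨0, hKi.integrableOn⟩
      have e : ⋂ T : ℝ, Ici T = ∅ := by
        ext x; simp; exact ⟨x + 1, by linarith⟩
      simpa [e] using this
    have h2 := h1.const_mul (- F 0)
    rw [mul_zero] at h2
    refine h2.congr fun T => ?_
    have e : ∫ t in Iic (0:ℝ), B t * K (T - t) = ∫ t in Iic (0:ℝ), - F 0 * K (T - t) :=
      setIntegral_congr_fun measurableSet_Iic fun t ht => by simp only [hB0 t ht]
    rw [e, integral_const_mul]
    congr 1
    rw [← integral_indicator measurableSet_Ici, ← integral_indicator measurableSet_Iic,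
      ← integral_sub_left_eq_self _ volume T]
    congr 1; ext t
    simp [indicator]
  have hBK : ∀ T : ℝ, Integrable (fun t => B t * K (T - t)) := by
    intro T
    refine (integrable_growth K hKc hKi hKs M ‖F 0‖ T).mono' (by fun_prop) ?_
    refine Eventually.of_forall fun t => ?_
    rw [norm_mul]; gcongr; exact hBg' t
  have hlim3 : Tendsto (fun T : ℝ => ∫ t : ℝ, B t * K (T - t)) atTop (nhds 0) := by
    have := hlim2.add hlim1
    rw [add_zero] at this
    refine this.congr fun T => ?_
    rw [← compl_Iic, integral_add_compl measurableSet_Iic (hBK T)]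
  have hev := (Metric.tendsto_nhds.1 hlim3) δ hδ
  filter_upwards [hev, eventually_gt_atTop 0] with T hT hT0
  rw [dist_zero_right] at hT
  have eB : (∫ t in (0 : ℝ)..T, a t) - F 0 = B T := by simp [B, max_eq_left hT0.le]
  rw [eB]
  have hKT : ∫ t, K (T - t) = 1 := by rw [integral_sub_left_eq_self, hK1]
  have e3 : B T = (∫ t, (B T - B t) * K (T - t)) + ∫ t : ℝ, B t * K (T - t) := by
    simp only [sub_mul]
    rw [integral_sub ((hKi.comp_sub_left T).const_mul _) (hBK T), integral_const_mul, hKT]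
    ring
  have e4 : ‖∫ t, (B T - B t) * K (T - t)‖ ≤ (∫ s : ℝ, |s| * ‖K s‖) * M := by
    rw [mul_comm, ← integral_const_mul, ← integral_sub_left_eq_self (fun s : ℝ => M * (|s| * ‖K s‖)) volume T]
    refine norm_integral_le_of_norm_le ((hKs.comp_sub_left T).const_mul M)
      (Eventually.of_forall fun t => ?_)
    rw [norm_mul, ← mul_assoc]
    gcongr
    exact hlip T t
  rw [e3]
  exact (norm_add_le _ _).trans (add_le_add e4 hT.le)

/-- Corollary 1.2: if the Laplace transform of the bounded function `a` extends
analytically to every point of the imaginary axis, then the improper integral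
`∫₀^{∞-} a(t) dt = lim_{T→∞} ∫₀ᵀ a(t) dt` exists and equals `f(0)`. -/
theorem stmt_6 (a : ℝ → ℂ) (M : ℝ) (ha : Measurable a)
    (hbd : ∀ t : ℝ, 0 < t → ‖a t‖ ≤ M)
    (F : ℂ → ℂ) (U : Set ℂ) (hU : IsOpen U)
    (haxis : {z : ℂ | z.re = 0} ⊆ U)
    (hF : DifferentiableOn ℂ F (U ∪ {z : ℂ | 0 < z.re}))
    (hFeq : ∀ z : ℂ, 0 < z.re →
      F z = ∫ t in Ioi (0 : ℝ), a t * Complex.exp (-z * t)) :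
    Tendsto (fun T : ℝ => ∫ t in (0 : ℝ)..T, a t) atTop (nhds (F 0)) := by
  obtain ⟨C, hC, h⟩ := approx_bound
  have hM : 0 ≤ M := (norm_nonneg _).trans (hbd 1 one_pos)
  rw [Metric.tendsto_nhds]
  intro η hη
  -- choose the scale
  let b : ℝ := η / (4 * (C * M + 1))
  have hCM : 0 ≤ C * M := by positivity
  have hb : 0 < b := by positivity
  have hbC : C * (b * M) ≤ η / 4 := by
    have : b * (C * M + 1) = η / 4 := by simp only [b]; field_simp
    nlinarith
  have h1 := h (fun t => b * a (b * t)) (b * M) (by fun_prop)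
    (fun t ht => by
      rw [norm_mul, Complex.norm_real, Real.norm_of_nonneg hb.le]
      gcongr
      exact hbd _ (by positivity))
    (fun z => F (z / b)) ((fun z : ℂ => z / b) ⁻¹' U) (hU.preimage (by fun_prop))
    (fun z hz => haxis (by
      have hz : z.re = 0 := hz
      simp [Complex.div_ofReal_re, hz]))
    (by
      refine hF.comp (by fun_prop) ?_
      rintro z (hz | hz)
      · exact Or.inl hz
      · right
        have hz : 0 < z.re := hz
        change 0 < (z / (b : ℂ)).re
        rw [Complex.div_ofReal_re]
        positivity)
    (fun z hz => by
      have hb' : (b : ℂ) ≠ 0 := by exact_mod_cast hb.ne'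
      rw [hFeq _ (by rw [Complex.div_ofReal_re]; positivity)]
      have := integral_comp_mul_left_Ioi' (fun t : ℝ => a t * cexp (-(z / b) * t)) 0 hb
      rw [mul_zero] at this
      rw [← this, ← integral_smul]
      congr 1; ext t
      rw [Complex.real_smul, ← mul_assoc]
      congr 2
      push_cast; field_simp)
    (η / 4) (by positivity)
  have h2 : Tendsto (fun T : ℝ => T / b) atTop atTop := tendsto_id.atTop_div_const hb
  filter_upwards [h2.eventually h1] with T hT
  have e : ∫ t in (0:ℝ)..(T / b), (b : ℂ) * a (b * t) = ∫ t in (0:ℝ)..T, a t := by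
    rw [intervalIntegral.integral_const_mul, ← Complex.real_smul,
      intervalIntegral.smul_integral_comp_mul_left]
    simp [mul_div_cancel₀ T hb.ne']
  rw [e, zero_div] at hT
  rw [dist_eq_norm]
  linarith
end

section
/- The improper integral ∫₁^{∞-} (ψ(v) - ⌊v⌋)/v² dv converges, with value g(0) = -(ζ'(1+s)/ζ(1+s) + ζ(1+s))/(1+s) evaluated at s = 0 via analytic continuation; equivalently Σ_{n=1}^∞ (Λ(n)-1)/n converges. -/
open Filter Finset Set

noncomputable def chebyshevPsi (v : ℝ) : ℝ :=
  ∑ n ∈ Finset.Iic ⌊v⌋₊, ArithmeticFunction.vonMangoldt n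


open MeasureTheory FourierTransform

theorem exists_kernel_s13 : ∃ φ : SchwartzMap ℝ ℂ, HasCompactSupport φ ∧ φ 0 = 1 := by
  let b : ContDiffBump (0:ℝ) := ⟨1, 2, by norm_num, by norm_num⟩
  have h1 : HasCompactSupport (fun x => (b x : ℂ)) :=
    b.hasCompactSupport.comp_left (g := fun x : ℝ => (x:ℂ)) (by simp)
  have h2 : ContDiff ℝ ((⊤ : ℕ∞) : WithTop ℕ∞) (fun x => (b x : ℂ)) := Complex.ofRealCLM.contDiff.comp b.contDiff
  refine ⟨h1.toSchwartzMap h2, h1, ?_⟩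
  change ((b 0 : ℝ) : ℂ) = 1
  have : b (0:ℝ) = 1 := b.one_of_mem_closedBall (by simp [b.rIn_pos.le])
  simp [this]

theorem int_fourier (φ : SchwartzMap ℝ ℂ) : ∫ u, (𝓕 φ) u = φ 0 := by
  have h : 𝓕⁻ (𝓕 φ) = φ := FourierTransform.fourierInv_fourier_eq φ
  have h2 := congrArg (fun f : SchwartzMap ℝ ℂ => f 0) h
  beta_reduce at h2
  rw [← h2, SchwartzMap.fourierInv_coe, Real.fourierInv_eq]
  simp

theorem P_int {P : ℝ → ℂ} {M : ℝ} (hP : ∀ s t, ‖P t - P s‖ ≤ M * |t - s|) (hc : Continuous P) (hM : 0 ≤ M)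
    {z : ℂ} (hz : 0 < z.re) : IntegrableOn (fun t : ℝ => P t * Complex.exp (-z * t)) (Ioi 0) := by
  have h0 := integrableOn_exp_mul_Ioi (a := -z.re/2) (by linarith) 0
  refine (h0.const_mul (‖P 0‖ + 2 * M / z.re)).mono' (by fun_prop) ?_
  refine (ae_restrict_iff' measurableSet_Ioi).2 (.of_forall fun t ht => ?_)
  have ht : 0 < t := ht
  rw [norm_mul, Complex.norm_exp]
  have e1 : (-z * (t:ℂ)).re = -z.re/2*t + -z.re/2*t := by simp; ring
  rw [e1, Real.exp_add, ← mul_assoc]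
  gcongr
  have h1 : ‖P t‖ ≤ ‖P 0‖ + M * t := by
    have := hP 0 t
    have h2 := norm_add_le (P t - P 0) (P 0)
    rw [sub_add_cancel, ] at h2
    rw [sub_zero, abs_of_pos ht] at this
    linarith
  have h2 : z.re / 2 * t + 1 ≤ Real.exp (z.re/2*t) := Real.add_one_le_exp _
  have h3 : (‖P 0‖ + M * t) ≤ (‖P 0‖ + 2 * M / z.re) * Real.exp (z.re/2*t) := by
    calc (‖P 0‖ + M * t) ≤ (‖P 0‖ + 2 * M / z.re) * (z.re / 2 * t + 1) := by
          have : (‖P 0‖ + 2 * M / z.re) * (z.re / 2 * t + 1) = ‖P 0‖ + M * t + ‖P 0‖ * (z.re / 2 * t) + 2 * M / z.re := by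
            field_simp; ring
          rw [this]
          have : 0 ≤ ‖P 0‖ * (z.re / 2 * t) := by positivity
          have : 0 ≤ 2 * M / z.re := by positivity
          linarith
      _ ≤ _ := by gcongr
  calc ‖P t‖ * Real.exp (-z.re/2*t) ≤ ((‖P 0‖ + 2 * M / z.re) * Real.exp (z.re/2*t)) * Real.exp (-z.re/2*t) := by
        gcongr; linarith
    _ = _ := by rw [mul_assoc, ← Real.exp_add]; ring_nf; simp

theorem A1x {P : ℝ → ℂ} {M : ℝ} (hP : ∀ s t, ‖P t - P s‖ ≤ M * |t - s|) (hc : Continuous P) (hM : 0 ≤ M)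
    {H : ℂ → ℂ} (hH : ∀ z : ℂ, 0 < z.re → ∫ t in Ioi (0:ℝ), P t * Complex.exp (-z * t) = H z)
    (φ : SchwartzMap ℝ ℂ) (l T x : ℝ) (hx : 0 < x) :
    ∫ t in Ioi (0:ℝ), P t * Complex.exp (-x * t) * (𝓕 φ) (l * (t - T)) =
      ∫ y, Complex.exp ((2 * Real.pi * y * (l * T) : ℝ) * Complex.I) * (φ y * H (x + (2 * Real.pi * l * y : ℝ) * Complex.I)) := by
  have hi := P_int hP hc hM (z := x) (by simpa using hx)
  have e1 : ∀ t : ℝ, P t * Complex.exp (-x * t) * (𝓕 φ) (l * (t - T)) =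
      ∫ y, (P t * Complex.exp (-x * t) * φ y) * Complex.exp ((-2 * Real.pi * y * (l * (t - T)) : ℝ) * Complex.I) := by
    intro t
    rw [SchwartzMap.fourier_coe, Real.fourier_real_eq_integral_exp_smul, ← integral_const_mul]
    congr 1; ext y; simp only [smul_eq_mul]; ring
  simp_rw [e1]
  rw [integral_integral_swap]
  · congr 1; ext y
    rw [← hH _ (by simpa using hx), ← mul_assoc, ← integral_const_mul]
    congr 1; ext t
    have : Complex.exp (-((x:ℂ) + (2 * Real.pi * l * y : ℝ) * Complex.I) * t) =
      Complex.exp (-x * t) * Complex.exp (-((2 * Real.pi * l * y : ℝ) * Complex.I) * t) := by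
      rw [← Complex.exp_add]; ring_nf
    rw [this]
    have : Complex.exp ((-2 * Real.pi * y * (l * (t - T)) : ℝ) * Complex.I) = 
      Complex.exp ((2 * Real.pi * y * (l * T) : ℝ) * Complex.I) * Complex.exp (-((2 * Real.pi * l * y : ℝ) * Complex.I) * t) := by
      rw [← Complex.exp_add]; push_cast; ring_nf
    rw [this]; ring
  · have := Integrable.mul_prod hi (φ.integrable (μ := volume))
    refine (this.bdd_mul (c := 1) (f := fun p : ℝ × ℝ => Complex.exp ((-2 * Real.pi * p.2 * (l * (p.1 - T)) : ℝ) * Complex.I)) (by fun_prop) (.of_forall fun p => ?_)).congr (.of_forall fun p => ?_)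
    · rw [Complex.norm_exp_ofReal_mul_I]
    · simp only [Function.uncurry]; ring

theorem A1 {P : ℝ → ℂ} {M : ℝ} (hP : ∀ s t, ‖P t - P s‖ ≤ M * |t - s|) (hc : Continuous P) (hM : 0 ≤ M)
    {H : ℂ → ℂ} (hH : ∀ z : ℂ, 0 < z.re → ∫ t in Ioi (0:ℝ), P t * Complex.exp (-z * t) = H z)
    (hHc : ContinuousOn H {z | 0 ≤ z.re})
    (φ : SchwartzMap ℝ ℂ) (hφ : HasCompactSupport φ) (K : ℝ → ℂ) (hK : Continuous K) (hKφ : ∀ u, K u = (𝓕 φ) u) (l T : ℝ) (hi : Integrable (fun t : ℝ => P t * K (l * (t - T)))) :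
    ∫ t in Ioi (0:ℝ), P t * K (l * (t - T)) =
      ∫ y, Complex.exp ((2 * Real.pi * y * (l * T) : ℝ) * Complex.I) * (φ y * H ((2 * Real.pi * l * y : ℝ) * Complex.I)) := by
  have t1 : Tendsto (fun x : ℝ => ∫ t in Ioi (0:ℝ), P t * Complex.exp (-x * t) * K (l * (t - T))) (nhdsWithin 0 (Ioi 0))
      (nhds (∫ t in Ioi (0:ℝ), P t * K (l * (t - T)))) := by
    refine tendsto_integral_filter_of_dominated_convergence (fun t => ‖P t * K (l * (t - T))‖) ?_ ?_ hi.norm.integrableOn ?_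
    · refine .of_forall fun x => ?_
      fun_prop
    · filter_upwards [self_mem_nhdsWithin] with x hx
      refine (ae_restrict_iff' measurableSet_Ioi).2 (.of_forall fun t ht => ?_)
      have hx : 0 < x := hx
      have ht : 0 < t := ht
      rw [norm_mul, norm_mul, norm_mul, Complex.norm_exp]
      have : Real.exp (-(x:ℂ) * t).re ≤ 1 := by
        rw [Real.exp_le_one_iff]; simp; positivity
      gcongr
      exact mul_le_of_le_one_right (norm_nonneg _) this
    · refine .of_forall fun t => ?_
      have : Continuous (fun x : ℝ => P t * Complex.exp (-x * t) * K (l * (t - T))) := by fun_prop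
      have h := this.tendsto 0
      simp only [Complex.ofReal_zero, neg_zero, zero_mul, Complex.exp_zero, mul_one] at h
      exact h.mono_left nhdsWithin_le_nhds
  have hcompact : IsCompact ((fun p : ℝ × ℝ => (p.1 : ℂ) + (2 * Real.pi * l * p.2 : ℝ) * Complex.I) '' (Set.Icc 0 1 ×ˢ tsupport φ)) :=
    (isCompact_Icc.prod hφ).image (by fun_prop)
  obtain ⟨C, hC⟩ := hcompact.exists_bound_of_continuousOn (f := H) (hHc.mono (by
    rintro _ ⟨p, hp, rfl⟩
    simpa using hp.1.1))
  have t2 : Tendsto (fun x : ℝ => ∫ y, Complex.exp ((2 * Real.pi * y * (l * T) : ℝ) * Complex.I) * (φ y * H (x + (2 * Real.pi * l * y : ℝ) * Complex.I))) (nhdsWithin 0 (Ioi 0))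
      (nhds (∫ y, Complex.exp ((2 * Real.pi * y * (l * T) : ℝ) * Complex.I) * (φ y * H ((2 * Real.pi * l * y : ℝ) * Complex.I)))) := by
    refine tendsto_integral_filter_of_dominated_convergence (fun y => ‖φ y‖ * C) ?_ ?_ (φ.integrable.norm.mul_const _) ?_
    · filter_upwards [self_mem_nhdsWithin] with x hx
      have : Continuous fun y : ℝ => H (x + (2 * Real.pi * l * y : ℝ) * Complex.I) := by
        refine hHc.comp_continuous (by fun_prop) (fun y => ?_)
        simpa using (le_of_lt hx)
      have h' := φ.continuous
      exact (Continuous.mul (by fun_prop) (h'.mul this)).aestronglyMeasurable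
    · filter_upwards [self_mem_nhdsWithin, mem_nhdsWithin_of_mem_nhds (Iio_mem_nhds one_pos)] with x hx hx1
      refine .of_forall fun y => ?_
      rw [norm_mul, Complex.norm_exp_ofReal_mul_I, one_mul, norm_mul]
      by_cases hy : y ∈ tsupport φ
      · gcongr
        exact hC _ ⟨(x, y), ⟨⟨le_of_lt hx, le_of_lt hx1⟩, hy⟩, rfl⟩
      · simp [image_eq_zero_of_notMem_tsupport hy]
    · refine .of_forall fun y => ?_
      refine Tendsto.const_mul _ (Tendsto.const_mul _ ?_)
      refine (hHc _ ?_).tendsto.comp (tendsto_nhdsWithin_iff.2 ⟨?_, ?_⟩)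
      · simp
      · have : Continuous (fun x : ℝ => (x:ℂ) + (2 * Real.pi * l * y : ℝ) * Complex.I) := by fun_prop
        have h := this.tendsto 0
        simp only [Complex.ofReal_zero, zero_add] at h
        exact h.mono_left nhdsWithin_le_nhds
      · filter_upwards [self_mem_nhdsWithin] with x hx
        simpa using le_of_lt hx
  refine tendsto_nhds_unique t1 (t2.congr' ?_)
  filter_upwards [self_mem_nhdsWithin] with x hx
  simp_rw [hKφ]
  exact (A1x hP hc hM hH φ l T x hx).symm

theorem A2 (q : ℝ → ℂ) {l : ℝ} (hl : 0 < l) : 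
   Tendsto (fun T : ℝ => ∫ y, Complex.exp ((2 * Real.pi * y * (l * T) : ℝ) * Complex.I) * q y) atTop (nhds 0) := by
  have h := (Real.zero_at_infty_fourier q).mono_left (atBot_le_cocompact)
  have h2 : Tendsto (fun T : ℝ => -l * T) atTop atBot := tendsto_id.const_mul_atTop_of_neg (by linarith)
  refine (h.comp h2).congr fun T => ?_
  simp only [Function.comp, Real.fourier_real_eq_integral_exp_smul]
  congr 1; ext y; simp only [smul_eq_mul]; congr 4; ring

theorem A3i {P : ℝ → ℂ} {M : ℝ} (hP : ∀ s t, ‖P t - P s‖ ≤ M * |t - s|) (hc : Continuous P)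
    (K : ℝ → ℂ) (hK : Continuous K) (h0 : Integrable K) (h1 : Integrable (fun u => |u| * ‖K u‖))
    (l T : ℝ) (hl : 0 < l) : Integrable (fun t : ℝ => P t * K (l * (t - T))) := by
  have k0 : Integrable (fun t => K (l * (t - T))) := (h0.comp_mul_left' hl.ne').comp_sub_right T
  have k1 : Integrable (fun t => |l * (t - T)| * ‖K (l * (t - T))‖) := (h1.comp_mul_left' hl.ne').comp_sub_right T
  refine ((k0.norm.const_mul ‖P T‖).add (k1.const_mul (M / l))).mono' (by fun_prop) (.of_forall fun t => ?_)
  have h2 := norm_add_le (P t - P T) (P T)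
  rw [sub_add_cancel] at h2
  have h3 := hP T t
  simp only [Pi.add_apply]
  rw [norm_mul, abs_mul, abs_of_pos hl]
  have : M / l * (l * |t - T| * ‖K (l * (t - T))‖) = M * |t - T| * ‖K (l * (t - T))‖ := by field_simp
  rw [this, ← add_mul]
  gcongr
  linarith

theorem A3 {P : ℝ → ℂ} {M : ℝ} (hP : ∀ s t, ‖P t - P s‖ ≤ M * |t - s|) (hc : Continuous P) (hM : 0 ≤ M)
    (K : ℝ → ℂ) (hK : Continuous K) (h0 : Integrable K) (hK1 : ∫ u, K u = 1) (h1 : Integrable (fun u => |u| * ‖K u‖))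
    (h2 : Integrable (fun u => |u| ^ 2 * ‖K u‖))
    (l T : ℝ) (hl : 0 < l) (hT : 1 ≤ T) : 
    ‖P T‖ ≤ l * ‖∫ t in Ioi (0:ℝ), P t * K (l * (t - T))‖ + M / l * (∫ u, |u| * ‖K u‖)
      + (‖P 0‖ + M) / (T * l ^ 2) * (∫ u, |u| ^ 2 * ‖K u‖) := by
  have k0 : Integrable (fun t => K (l * (t - T))) := (h0.comp_mul_left' hl.ne').comp_sub_right T
  have k1 : Integrable (fun t => |l * (t - T)| * ‖K (l * (t - T))‖) := (h1.comp_mul_left' hl.ne').comp_sub_right T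
  have k2 : Integrable (fun t => |l * (t - T)| ^ 2 * ‖K (l * (t - T))‖) := (h2.comp_mul_left' hl.ne').comp_sub_right T
  have kP := A3i hP hc K hK h0 h1 l T hl
  have I0 : ∫ t, K (l * (t - T)) = (l⁻¹ : ℝ) := by
    rw [integral_sub_right_eq_self (fun t => K (l * t)), Measure.integral_comp_mul_left, hK1, abs_of_pos (inv_pos.2 hl)]
    simp
  have I1 : ∫ t, |l * (t - T)| * ‖K (l * (t - T))‖ = l⁻¹ * ∫ u, |u| * ‖K u‖ := by
    rw [integral_sub_right_eq_self (fun t => |l * t| * ‖K (l * t)‖), Measure.integral_comp_mul_left (fun t => |t| * ‖K t‖), abs_of_pos (inv_pos.2 hl)]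
    simp
  have I2 : ∫ t, |l * (t - T)| ^ 2 * ‖K (l * (t - T))‖ = l⁻¹ * ∫ u, |u| ^ 2 * ‖K u‖ := by
    rw [integral_sub_right_eq_self (fun t => |l * t| ^ 2 * ‖K (l * t)‖), Measure.integral_comp_mul_left (fun t => |t| ^ 2 * ‖K t‖), abs_of_pos (inv_pos.2 hl)]
    simp
  rw [← integral_indicator measurableSet_Ioi]
  set J := ∫ t, (Ioi (0:ℝ)).indicator (fun t => P t * K (l * (t - T))) t with hJ
  have key : ‖P T * (l⁻¹ : ℝ) - J‖ ≤ M / l * (l⁻¹ * ∫ u, |u| * ‖K u‖) + (‖P 0‖ + M) / (T * l ^ 2) * (l⁻¹ * ∫ u, |u| ^ 2 * ‖K u‖) := by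
    rw [← I0, ← I1, ← I2, hJ, ← integral_const_mul, ← integral_const_mul, ← integral_const_mul, ← integral_sub (k0.const_mul _) (kP.indicator measurableSet_Ioi),
      ← integral_add (k1.const_mul _) (k2.const_mul _)]
    refine norm_integral_le_of_norm_le ((k1.const_mul _).add (k2.const_mul _)) (.of_forall fun t => ?_)
    have e1 : M / l * (|l * (t - T)| * ‖K (l * (t - T))‖) = M * |t - T| * ‖K (l * (t - T))‖ := by
      rw [abs_mul, abs_of_pos hl]; field_simp
    have e2 : (‖P 0‖ + M) / (T * l ^ 2) * (|l * (t - T)| ^ 2 * ‖K (l * (t - T))‖) = (‖P 0‖ + M) / T * |t - T| ^ 2 * ‖K (l * (t - T))‖ := by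
      rw [abs_mul, abs_of_pos hl]; field_simp
    rw [e1, e2, ← add_mul]
    by_cases ht : 0 < t
    · rw [indicator_of_mem (by exact ht), ← sub_mul, norm_mul]
      gcongr
      have := hP t T
      rw [abs_sub_comm] at this
      have : 0 ≤ (‖P 0‖ + M) / T * |t - T| ^ 2 := by positivity
      linarith
    · rw [indicator_of_notMem (by exact ht), sub_zero, norm_mul]
      gcongr
      have h3 := hP 0 T
      rw [sub_zero, abs_of_pos (by linarith)] at h3
      have h4 := norm_add_le (P T - P 0) (P 0)
      rw [sub_add_cancel] at h4
      have h5 : T ^ 2 ≤ |t - T| ^ 2 := by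
        rw [sq_abs]; nlinarith
      have h6 : (‖P 0‖ + M) / T * T ^ 2 ≤ (‖P 0‖ + M) / T * |t - T| ^ 2 := by gcongr
      have h7 : (‖P 0‖ + M) / T * T ^ 2 = (‖P 0‖ + M) * T := by field_simp
      have h8 : 0 ≤ M * |t - T| := by positivity
      nlinarith [norm_nonneg (P 0)]
  have e : P T = l * (P T * (l⁻¹ : ℝ) - J) + l * J := by
    have : (l:ℂ) ≠ 0 := by exact_mod_cast hl.ne'
    push_cast; field_simp; ring
  have n := norm_add_le (l * (P T * (l⁻¹ : ℝ) - J)) (l * J)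
  rw [← e, norm_mul, norm_mul, Complex.norm_real, Real.norm_of_nonneg hl.le] at n
  have := mul_le_mul_of_nonneg_left key hl.le
  have e3 : l * (M / l * (l⁻¹ * ∫ u, |u| * ‖K u‖) + (‖P 0‖ + M) / (T * l ^ 2) * (l⁻¹ * ∫ u, |u| ^ 2 * ‖K u‖)) = M / l * (∫ u, |u| * ‖K u‖) + (‖P 0‖ + M) / (T * l ^ 2) * (∫ u, |u| ^ 2 * ‖K u‖) := by
    field_simp
  linarith

theorem tauber {P : ℝ → ℂ} {M : ℝ} (hP : ∀ s t, ‖P t - P s‖ ≤ M * |t - s|) (hc : Continuous P) (hM : 0 ≤ M)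
    {H : ℂ → ℂ} (hH : ∀ z : ℂ, 0 < z.re → ∫ t in Ioi (0:ℝ), P t * Complex.exp (-z * t) = H z)
    (hHc : ContinuousOn H {z | 0 ≤ z.re}) : Tendsto P atTop (nhds 0) := by
  obtain ⟨φ, hφ, hφ0⟩ := exists_kernel_s13
  obtain ⟨K, hKφ⟩ : ∃ K : ℝ → ℂ, ∀ u, K u = (𝓕 φ) u := ⟨_, fun _ => rfl⟩
  have hKe : K = (𝓕 φ : SchwartzMap ℝ ℂ) := funext hKφ
  have hK : Continuous K := hKe ▸ (𝓕 φ).continuous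
  have h0 : Integrable K := hKe ▸ (𝓕 φ).integrable
  have h1 : Integrable (fun u => |u| * ‖K u‖) := by
    refine ((𝓕 φ : SchwartzMap ℝ ℂ).integrable_pow_mul volume 1).congr (.of_forall fun u => ?_)
    simp only [hKφ, Real.norm_eq_abs, pow_one]
  have h2 : Integrable (fun u => |u| ^ 2 * ‖K u‖) := by
    refine ((𝓕 φ : SchwartzMap ℝ ℂ).integrable_pow_mul volume 2).congr (.of_forall fun u => ?_)
    simp only [hKφ, Real.norm_eq_abs]
  have hK1 : ∫ u, K u = 1 := by
    simp_rw [hKφ]; rw [int_fourier, hφ0]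
  set C1 := ∫ u, |u| * ‖K u‖
  set C2 := ∫ u, |u| ^ 2 * ‖K u‖
  rw [tendsto_zero_iff_norm_tendsto_zero]
  have hC1 : 0 ≤ C1 := integral_nonneg fun u => by positivity
  rw [Metric.tendsto_atTop']
  intro ε hε
  have hex : ∃ l : ℝ, 0 < l ∧ M / l * C1 < ε / 2 := by
    refine ⟨2 * (M * C1 + 1) / ε, by positivity, ?_⟩
    rw [div_mul_eq_mul_div, div_lt_iff₀ (by positivity)]
    field_simp
    linarith
  obtain ⟨l, hl, hle⟩ := hex
  have tA : Tendsto (fun T : ℝ => ∫ t in Ioi (0:ℝ), P t * K (l * (t - T))) atTop (nhds 0) := by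
    refine (A2 (fun y => φ y * H ((2 * Real.pi * l * y : ℝ) * Complex.I)) hl).congr fun T => ?_
    exact (A1 hP hc hM hH hHc φ hφ K hK hKφ l T (A3i hP hc K hK h0 h1 l T hl)).symm
  have tB : Tendsto (fun T : ℝ => (‖P 0‖ + M) / (T * l ^ 2) * C2) atTop (nhds 0) := by
    have : Tendsto (fun T : ℝ => (‖P 0‖ + M) / (l ^ 2) * C2 * T⁻¹) atTop (nhds ((‖P 0‖ + M) / (l ^ 2) * C2 * 0)) :=
      tendsto_inv_atTop_zero.const_mul _
    rw [mul_zero] at this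
    refine this.congr fun T => ?_
    field_simp
  have tC := (tA.norm.const_mul l).add tB
  simp only [norm_zero, mul_zero, add_zero] at tC
  have := (tC.eventually_lt_const (half_pos hε)).and (eventually_ge_atTop 1)
  obtain ⟨N, hN⟩ := eventually_atTop.1 this
  refine ⟨N, fun T hT => ?_⟩
  obtain ⟨q1, q2⟩ := hN T hT.le
  have := A3 hP hc hM K hK h0 hK1 h1 h2 l T hl q2
  simp only [dist_zero_right, norm_norm]
  linarith
theorem laplace_prim {f : ℝ → ℂ} (hf : Measurable f) {M : ℝ} (hM : ∀ t, ‖f t‖ ≤ M) {z : ℂ} (hz : 0 < z.re) :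
    ∫ t in Ioi (0:ℝ), (∫ s in (0:ℝ)..t, f s) * Complex.exp (-z * t) = (∫ s in Ioi (0:ℝ), f s * Complex.exp (-z * s)) / z := by
  have hM0 : 0 ≤ M := (norm_nonneg _).trans (hM 0)
  have e1 : ∀ t ∈ Ioi (0:ℝ), (∫ s in (0:ℝ)..t, f s) * Complex.exp (-z * t) =
      ∫ s in Ioi (0:ℝ), ({p : ℝ × ℝ | p.2 ≤ p.1}.indicator (fun p => f p.2 * Complex.exp (-z * p.1)) (t, s)) := by
    intro t ht
    rw [intervalIntegral.integral_of_le (le_of_lt ht), ← integral_mul_const, ← Ioi_inter_Iic, ← setIntegral_indicator measurableSet_Iic]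
    rfl
  rw [setIntegral_congr_fun measurableSet_Ioi e1]
  rw [integral_integral_swap (f := fun t s : ℝ => ({p : ℝ × ℝ | p.2 ≤ p.1}.indicator (fun p => f p.2 * Complex.exp (-z * p.1)) (t, s)))]
  · rw [← integral_div]
    refine setIntegral_congr_fun measurableSet_Ioi fun s hs => ?_
    have e2 : ∫ t in Ioi (0:ℝ), ({p : ℝ × ℝ | p.2 ≤ p.1}.indicator (fun p => f p.2 * Complex.exp (-z * p.1)) (t, s)) = ∫ t in Ioi (0:ℝ), (Ici s).indicator (fun t : ℝ => f s * Complex.exp (-z * t)) t := rfl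
    beta_reduce
    have hs : 0 < s := hs
    rw [e2, setIntegral_indicator measurableSet_Ici, inter_eq_self_of_subset_right (Ici_subset_Ioi.2 hs), integral_Ici_eq_integral_Ioi, integral_const_mul, integral_exp_mul_complex_Ioi (by simpa using hz)]
    rw [neg_div_neg_eq]; ring
  · have h0 := integrableOn_exp_mul_Ioi (a := -z.re/2) (by linarith) 0
    have h1 := (Integrable.mul_prod h0 h0).const_mul M
    refine h1.mono' ?_ ?_
    · refine AEStronglyMeasurable.indicator ?_ (measurableSet_le measurable_snd measurable_fst)
      exact Measurable.aestronglyMeasurable (by fun_prop)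
    · rw [Measure.prod_restrict]
      refine (ae_restrict_iff' (measurableSet_Ioi.prod measurableSet_Ioi)).2 (.of_forall fun p hp => ?_)
      change ‖({p : ℝ × ℝ | p.2 ≤ p.1}.indicator (fun p => f p.2 * Complex.exp (-z * p.1)) p)‖ ≤ _
      by_cases h : p.2 ≤ p.1
      · rw [indicator_of_mem (by exact h), norm_mul, Complex.norm_exp, ← Real.exp_add]
        gcongr
        · exact hM _
        · simp
          nlinarith
      · rw [indicator_of_notMem (by exact h), norm_zero]
        positivity

theorem newman {f : ℝ → ℝ} (hf : Measurable f) {M : ℝ} (hM : ∀ t, |f t| ≤ M) {H : ℂ → ℂ} {c : ℂ}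
    (hHc : ContinuousOn H {z | 0 ≤ z.re})
    (hL : ∀ z : ℂ, 0 < z.re → ∫ t in Ioi (0:ℝ), (f t : ℂ) * Complex.exp (-z * t) = z * H z + c) :
    Tendsto (fun T : ℝ => ∫ t in (0:ℝ)..T, f t) atTop (nhds c.re) := by
  have hM0 : 0 ≤ M := (abs_nonneg _).trans (hM 0)
  have hi : ∀ a b, IntervalIntegrable (fun t => (f t : ℂ)) volume a b := by
    intro a b
    refine (intervalIntegrable_const (c := M)).mono_fun (by fun_prop) (.of_forall fun t => ?_)
    simp only [Complex.norm_real, Real.norm_eq_abs]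
    exact (hM t).trans (le_abs_self _)
  have hlip : ∀ s t, ‖((∫ u in (0:ℝ)..t, (f u : ℂ)) - c) - ((∫ u in (0:ℝ)..s, (f u : ℂ)) - c)‖ ≤ M * |t - s| := by
    intro s t
    rw [sub_sub_sub_cancel_right, intervalIntegral.integral_interval_sub_left (hi _ _) (hi _ _)]
    refine intervalIntegral.norm_integral_le_of_norm_le_const fun x _ => ?_
    simpa using hM x
  have hcont : Continuous (fun t : ℝ => (∫ u in (0:ℝ)..t, (f u : ℂ)) - c) :=
    (intervalIntegral.continuous_primitive hi 0).sub continuous_const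
  have h := tauber (P := fun t => (∫ u in (0:ℝ)..t, (f u : ℂ)) - c) hlip hcont hM0 (H := H) ?_ hHc
  · have h2 := (h.add_const c)
    simp only [sub_add_cancel, zero_add] at h2
    refine ((Complex.continuous_re.tendsto c).comp h2).congr fun T => ?_
    simp [intervalIntegral.integral_ofReal]
  · intro z hz
    have z0 : z ≠ 0 := by rintro rfl; simp at hz
    have p1 := P_int hlip hcont hM0 hz
    have p2 : IntegrableOn (fun t : ℝ => c * Complex.exp (-z * t)) (Ioi 0) :=
      (integrableOn_exp_mul_complex_Ioi (by simpa using hz) 0).const_mul c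
    have : ∫ t in Ioi (0:ℝ), ((∫ u in (0:ℝ)..t, (f u : ℂ)) - c) * Complex.exp (-z * t) = (∫ t in Ioi (0:ℝ), (∫ u in (0:ℝ)..t, (f u : ℂ)) * Complex.exp (-z * t)) - ∫ t in Ioi (0:ℝ), c * Complex.exp (-z * t) := by
      rw [eq_sub_iff_add_eq, ← integral_add p1 p2]
      congr 1; ext t; ring
    rw [this, laplace_prim (by fun_prop) (M := M) (by simpa using hM) hz, hL z hz, integral_const_mul, integral_exp_mul_complex_Ioi (by simpa using hz)]
    simp
    field_simp
    ring

theorem zetaH : ∃ (H : ℂ → ℂ) (c : ℂ), ContinuousOn H {z | 0 ≤ z.re} ∧ ∀ z : ℂ, 0 < z.re →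
    (1 / (z + 1)) * (-(deriv riemannZeta (z + 1)) / riemannZeta (z + 1) - riemannZeta (z + 1)) = z * H z + c := by
  let E : ℂ → ℂ := Function.update (fun s => (s - 1) * riemannZeta s) 1 1
  have hE1 : E 1 = 1 := by simp [E]
  have hEne : ∀ s, s ≠ 1 → E s = (s - 1) * riemannZeta s := fun s hs => by simp [E, hs]
  have hEd : Differentiable ℂ E := by
    rw [← differentiableOn_univ, ← Complex.differentiableOn_compl_singleton_and_continuousAt_iff (c := 1) univ_mem]
    refine ⟨?_, ?_⟩
    · refine DifferentiableOn.congr (f := fun s => (s - 1) * riemannZeta s) ?_ (fun s hs => hEne s (by simpa using hs))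
      intro s hs
      have := differentiableAt_riemannZeta (s := s) (by simpa using hs)
      exact DifferentiableAt.differentiableWithinAt (by fun_prop)
    · exact continuousAt_update_same.2 riemannZeta_residue_one
  have hE0 : ∀ s : ℂ, 1 ≤ s.re → E s ≠ 0 := by
    intro s hs
    by_cases h : s = 1
    · rw [h, hE1]; simp
    · rw [hEne s h]
      exact mul_ne_zero (sub_ne_zero.2 h) (riemannZeta_ne_zero_of_one_le_re hs)
  have hdE : Differentiable ℂ (deriv E) := by
    have := hEd.contDiff (n := 2)
    exact (ContDiff.differentiable_deriv_two this)
  have hsl : Differentiable ℂ (dslope E 1) := by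
    rw [← differentiableOn_univ, Complex.differentiableOn_dslope univ_mem]
    exact hEd.differentiableOn
  let g : ℂ → ℂ := fun z => -(1 / (z + 1)) * (deriv E (z + 1) / E (z + 1) + dslope E 1 (z + 1))
  let V : Set ℂ := {z | z + 1 ≠ 0 ∧ E (z + 1) ≠ 0}
  have hVo : IsOpen V := by
    have := hEd.continuous
    exact (isOpen_ne_fun (by fun_prop) (by fun_prop)).inter (isOpen_ne_fun (by fun_prop) (by fun_prop))
  have hV : {z : ℂ | 0 ≤ z.re} ⊆ V := by
    intro z hz
    have hz : 0 ≤ z.re := hz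
    refine ⟨fun h => ?_, hE0 _ (by simpa using hz)⟩
    have := congrArg Complex.re h
    simp at this; linarith
  have hg : DifferentiableOn ℂ g V := by
    intro z hz
    refine DifferentiableAt.differentiableWithinAt ?_
    have h1 := hz.1
    have h2 := hz.2
    have d1 : DifferentiableAt ℂ (fun z => E (z + 1)) z := by fun_prop
    have d2 : DifferentiableAt ℂ (fun z => deriv E (z + 1)) z := hdE.differentiableAt.comp z (by fun_prop)
    have d3 : DifferentiableAt ℂ (fun z => dslope E 1 (z + 1)) z := hsl.differentiableAt.comp z (by fun_prop)
    have d4 : DifferentiableAt ℂ (fun z : ℂ => 1 / (z + 1)) z := DifferentiableAt.div (by fun_prop) (by fun_prop) h1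
    exact d4.neg.mul ((d2.div d1 h2).add d3)
  refine ⟨dslope g 0, g 0, ?_, fun z hz => ?_⟩
  · exact (((Complex.differentiableOn_dslope (hVo.mem_nhds (hV (by simp)))).2 hg).continuousOn).mono hV
  · have z0 : z ≠ 0 := by rintro rfl; simp at hz
    have e : z * dslope g 0 z + g 0 = g z := by
      have := sub_smul_dslope g 0 z
      simp only [sub_zero, smul_eq_mul] at this
      rw [this]; ring
    rw [e]
    have s1 : z + 1 ≠ 1 := by simpa using z0
    have hd : deriv E (z + 1) = riemannZeta (z + 1) + z * deriv riemannZeta (z + 1) := by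
      have h1 : E =ᶠ[nhds (z + 1)] fun s => (s - 1) * riemannZeta s := by
        filter_upwards [isOpen_ne.mem_nhds s1] with s hs using hEne s hs
      rw [h1.deriv_eq]
      have h2 := ((hasDerivAt_id (z+1)).sub_const 1).mul (differentiableAt_riemannZeta s1).hasDerivAt
      have h3 := h2.deriv
      simp only [id, one_mul, add_sub_cancel_right] at h3
      exact h3
    have hs : dslope E 1 (z + 1) = (z * riemannZeta (z + 1) - 1) / z := by
      rw [dslope_of_ne _ s1, slope_def_field, hE1, hEne _ s1]; simp
    have hz' : riemannZeta (z + 1) ≠ 0 := riemannZeta_ne_zero_of_one_le_re (by simpa using hz.le)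
    simp only [g]
    rw [hd, hs, hEne _ s1]
    rw [add_sub_cancel_right]
    have h1 : z + 1 ≠ 0 := (hV (show 0 ≤ z.re from hz.le)).1
    field_simp
    ring

theorem cpsi_eq (v : ℝ) : chebyshevPsi v = Chebyshev.psi v := by
  rw [Chebyshev.psi_eq_sum_Icc]; rfl

theorem cpsi_mono : Monotone chebyshevPsi := by
  have : chebyshevPsi = Chebyshev.psi := funext cpsi_eq
  rw [this]; exact Chebyshev.psi_mono

theorem psiA_bound {v : ℝ} (hv : 0 ≤ v) : |chebyshevPsi v - (⌊v⌋ : ℝ)| ≤ (Real.log 4 + 5) * v := by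
  have h1 := Chebyshev.psi_le_const_mul_self hv
  have h2 := Chebyshev.psi_nonneg v
  have h3 := Int.floor_le v
  have h4 : (0:ℝ) ≤ ⌊v⌋ := by exact_mod_cast Int.floor_nonneg.2 hv
  have h5 : 0 ≤ Real.log 4 := Real.log_nonneg (by norm_num)
  rw [cpsi_eq, abs_le]
  constructor <;> nlinarith

theorem psiA_meas : Measurable (fun v : ℝ => chebyshevPsi v - (⌊v⌋ : ℝ)) := by
  have := cpsi_mono.measurable
  fun_prop

theorem psiA_sum {v : ℝ} (hv : 0 ≤ v) : 
    ∑ k ∈ Finset.Icc 1 ⌊v⌋₊, (ArithmeticFunction.vonMangoldt k - 1) = chebyshevPsi v - (⌊v⌋ : ℝ) := by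
  have h : ((⌊v⌋₊ : ℕ) : ℝ) = (⌊v⌋ : ℝ) := natCast_floor_eq_intCast_floor hv
  rw [cpsi_eq, Chebyshev.psi, Finset.sum_sub_distrib, ← h]
  simp
  rfl

theorem psiA_ii {a b : ℝ} (ha : 1 ≤ a) (hb : 1 ≤ b) :
    IntervalIntegrable (fun v : ℝ => (chebyshevPsi v - (⌊v⌋ : ℝ)) / v ^ 2) volume a b := by
  have := psiA_meas
  refine (intervalIntegrable_const (c := Real.log 4 + 5)).mono_fun (Measurable.aestronglyMeasurable (by fun_prop)) ?_
  refine (ae_restrict_iff' measurableSet_uIoc).2 (.of_forall fun v hv => ?_)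
  have hv1 : 1 < v := lt_of_le_of_lt (le_min ha hb) hv.1
  have h5 : 0 ≤ Real.log 4 := Real.log_nonneg (by norm_num)
  change ‖_‖ ≤ |_|
  rw [Real.norm_eq_abs, abs_of_nonneg (a := Real.log 4 + 5) (by linarith), abs_div, abs_of_pos (a := v ^ 2) (by positivity), div_le_iff₀ (by positivity)]
  refine (psiA_bound (by linarith)).trans ?_
  gcongr
  nlinarith

theorem subst_int {T : ℝ} (hT : 1 ≤ T) : ∫ t in (0:ℝ)..Real.log T, (chebyshevPsi (Real.exp t) - (⌊Real.exp t⌋ : ℝ)) / Real.exp t =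
    ∫ v in (1 : ℝ)..T, (chebyshevPsi v - (⌊v⌋ : ℝ)) / v ^ 2 := by
  rw [intervalIntegral.integral_of_le hT, intervalIntegral.integral_of_le (Real.log_nonneg hT)]
  have him : Real.exp '' (Set.Ioc 0 (Real.log T)) = Set.Ioc 1 T := by
    ext x; constructor
    · rintro ⟨t, ⟨h1, h2⟩, rfl⟩
      exact ⟨Real.one_lt_exp_iff.2 h1, by rwa [← Real.le_log_iff_exp_le (by linarith)]⟩
    · rintro ⟨h1, h2⟩
      exact ⟨Real.log x, ⟨Real.log_pos h1, Real.log_le_log (by linarith) h2⟩, Real.exp_log (by linarith)⟩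
  rw [← him, integral_image_eq_integral_abs_deriv_smul measurableSet_Ioc (fun x _ => (Real.hasDerivAt_exp x).hasDerivWithinAt) Real.exp_injective.injOn]
  congr 1; ext t
  rw [abs_of_pos (Real.exp_pos t), smul_eq_mul]
  field_simp

theorem laplace_psiA {z : ℂ} (hz : 0 < z.re) :
    ∫ t in Ioi (0:ℝ), (((chebyshevPsi (Real.exp t) - (⌊Real.exp t⌋ : ℝ)) / Real.exp t : ℝ) : ℂ) * Complex.exp (-z * t) =
    (1 / (z + 1)) * (-(deriv riemannZeta (z + 1)) / riemannZeta (z + 1) - riemannZeta (z + 1)) := by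
  have hs : 1 < (z + 1).re := by simpa using hz
  have s1 := ArithmeticFunction.LSeriesSummable_vonMangoldt hs
  have s2 : LSeriesSummable 1 (z + 1) := LSeriesSummable_one_iff.2 hs
  have hO : (fun n ↦ ∑ k ∈ Finset.Icc 1 n, ((fun n => (ArithmeticFunction.vonMangoldt n : ℂ)) - 1) k) =O[atTop] fun n ↦ (n : ℝ) ^ (1:ℝ) := by
    refine Asymptotics.IsBigO.of_bound (Real.log 4 + 5) (.of_forall fun n => ?_)
    have h1 := psiA_sum (v := n) (by positivity)
    have h2 := psiA_bound (v := n) (by positivity)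
    rw [← h1, Nat.floor_natCast] at h2
    rw [Real.rpow_one, Real.norm_of_nonneg (by positivity)]
    refine le_trans (le_of_eq ?_) h2
    rw [← Real.norm_eq_abs, ← Complex.norm_real]
    simp
  have h := LSeries_eq_mul_integral _ zero_le_one hs (s1.sub s2) hO
  rw [LSeries_sub s1 s2, ArithmeticFunction.LSeries_vonMangoldt_eq_deriv_riemannZeta_div hs, LSeries_one_eq_riemannZeta hs] at h
  have hz1 : z + 1 ≠ 0 := by
    intro h; rw [h] at hs; simp at hs; linarith
  rw [h, ← mul_assoc, one_div_mul_cancel hz1, one_mul, ← Real.exp_zero, ← integral_comp_exp_Ioi]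
  congr 1; ext t
  rw [Complex.real_smul]
  have e1 : ∑ k ∈ Finset.Icc 1 ⌊Real.exp t⌋₊, ((fun n => (ArithmeticFunction.vonMangoldt n : ℂ)) - 1) k = ((chebyshevPsi (Real.exp t) - (⌊Real.exp t⌋ : ℝ) : ℝ) : ℂ) := by
    rw [← psiA_sum (Real.exp_pos t).le]; simp
  rw [e1]
  have e2 : ((Real.exp t : ℝ) : ℂ) ^ (-(z + 1 + 1)) = (((Real.exp t)⁻¹ : ℝ) : ℂ) ^ 2 * Complex.exp (-z * t) := by
    rw [Complex.cpow_def_of_ne_zero (by exact_mod_cast (Real.exp_pos t).ne'), ← Complex.ofReal_log (Real.exp_pos t).le, Real.log_exp, ← Real.exp_neg, Complex.ofReal_exp, ← Complex.exp_nat_mul, ← Complex.exp_add]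
    push_cast; ring_nf
  rw [e2]
  have : ((Real.exp t : ℝ) : ℂ) ≠ 0 := by exact_mod_cast (Real.exp_pos t).ne'
  push_cast
  push_cast at this
  field_simp

theorem int_conv : ∃ c : ℂ, (∃ H : ℂ → ℂ, ContinuousOn H {z | 0 ≤ z.re} ∧ ∀ z : ℂ, 0 < z.re →
    (1 / (z + 1)) * (-(deriv riemannZeta (z + 1)) / riemannZeta (z + 1) - riemannZeta (z + 1)) = z * H z + c) ∧
    Tendsto (fun T : ℝ => ∫ v in (1 : ℝ)..T, (chebyshevPsi v - (⌊v⌋ : ℝ)) / v ^ 2) atTop (nhds c.re) := by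
  obtain ⟨H, c, hH, hc⟩ := zetaH
  refine ⟨c, ⟨H, hH, hc⟩, ?_⟩
  have hm : Measurable (fun t : ℝ => (chebyshevPsi (Real.exp t) - (⌊Real.exp t⌋ : ℝ)) / Real.exp t) :=
    (psiA_meas.comp Real.measurable_exp).div Real.measurable_exp
  have h := newman hm (M := Real.log 4 + 5) (fun t => ?_) hH (c := c) (fun z hz => by rw [laplace_psiA hz, hc z hz])
  · refine (h.comp Real.tendsto_log_atTop).congr' ?_
    filter_upwards [eventually_ge_atTop 1] with T hT
    exact subst_int hT
  · rw [abs_div, abs_of_pos (Real.exp_pos t), div_le_iff₀ (Real.exp_pos t)]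
    exact psiA_bound (Real.exp_pos t).le

theorem int_calc {C a b : ℝ} (ha : 0 < a) (hab : a ≤ b) :
    IntervalIntegrable (fun v : ℝ => (C - v) / v ^ 2) volume a b ∧
    ∫ v in a..b, (C - v) / v ^ 2 = C * (1 / a - 1 / b) - (Real.log b - Real.log a) := by
  have hpos : ∀ x ∈ uIcc a b, 0 < x := fun x hx => by
    rw [uIcc_of_le hab] at hx; linarith [hx.1]
  have hi : IntervalIntegrable (fun v : ℝ => (C - v) / v ^ 2) volume a b := by
    refine ContinuousOn.intervalIntegrable ?_
    refine ContinuousOn.div (by fun_prop) (by fun_prop) fun x hx => ?_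
    have := hpos x hx
    positivity
  refine ⟨hi, ?_⟩
  rw [intervalIntegral.integral_eq_sub_of_hasDerivAt (f := fun v => -C * v⁻¹ - Real.log v) ?_ hi]
  · field_simp; ring
  · intro x hx
    have hx := hpos x hx
    have := ((hasDerivAt_inv hx.ne').const_mul (-C)).sub (Real.hasDerivAt_log hx.ne')
    refine HasDerivAt.congr_deriv this ?_
    field_simp

theorem pnt {c : ℝ} (hI : Tendsto (fun T : ℝ => ∫ v in (1 : ℝ)..T, (chebyshevPsi v - (⌊v⌋ : ℝ)) / v ^ 2) atTop (nhds c)) :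
    Tendsto (fun x : ℝ => chebyshevPsi x / x) atTop (nhds 1) := by
  have hcau : ∀ k : ℝ, 0 < k → Tendsto (fun x : ℝ => ∫ v in x..(k * x), (chebyshevPsi v - (⌊v⌋ : ℝ)) / v ^ 2) atTop (nhds 0) := by
    intro k hk
    have h1 := (hI.comp (tendsto_id.const_mul_atTop hk)).sub hI
    rw [sub_self] at h1
    refine h1.congr' ?_
    filter_upwards [eventually_ge_atTop 1, eventually_ge_atTop (1/k)] with x hx hx2
    have : 1 ≤ k * x := by rw [div_le_iff₀ hk] at hx2; linarith
    exact intervalIntegral.integral_interval_sub_left (psiA_ii le_rfl this) (psiA_ii le_rfl hx)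
  have up : ∀ ε : ℝ, 0 < ε → ∀ᶠ x : ℝ in atTop, chebyshevPsi x / x ≤ (1 + ε) ^ 2 := by
    intro ε hε
    filter_upwards [(hcau (1 + ε) (by linarith)).eventually_lt_const (show 0 < ε ^ 2 by positivity), eventually_ge_atTop 1] with x hx hx1
    have hx0 : 0 < x := by linarith
    have hxx : x ≤ (1 + ε) * x := by nlinarith
    obtain ⟨i1, i2⟩ := int_calc (C := chebyshevPsi x) hx0 hxx
    have hm := intervalIntegral.integral_mono_on hxx i1 (psiA_ii hx1 (hx1.trans hxx)) (fun v hv => by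
      have := cpsi_mono hv.1
      have h2 := Int.floor_le v
      have : 0 < v := by linarith [hv.1]
      gcongr)
    rw [i2, Real.log_mul (by positivity) (by positivity)] at hm
    have hl := Real.log_le_sub_one_of_pos (show 0 < 1 + ε by linarith)
    have e : chebyshevPsi x * (1 / x - 1 / ((1 + ε) * x)) = chebyshevPsi x / x * (ε / (1 + ε)) := by
      field_simp; ring
    rw [e] at hm
    have h3 : chebyshevPsi x / x * (ε / (1 + ε)) ≤ ε * (1 + ε) := by nlinarith
    rw [← le_div_iff₀ (by positivity)] at h3
    refine h3.trans (le_of_eq ?_)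
    field_simp
  have low : ∀ ε : ℝ, 0 < ε → ε < 1 → ∀ᶠ x : ℝ in atTop, (1 - ε) ^ 2 ≤ (chebyshevPsi x + 1) / x := by
    intro ε hε hε1
    have hp : 0 < 1 - ε := by linarith
    filter_upwards [(hcau (1 - ε) hp).eventually_lt_const (show 0 < ε ^ 2 by positivity), eventually_ge_atTop 1, eventually_ge_atTop (1 / (1 - ε))] with x hx hx1 hx2
    have hx0 : 0 < x := by linarith
    have hxx : (1 - ε) * x ≤ x := by nlinarith
    have hx3 : 1 ≤ (1 - ε) * x := by rw [div_le_iff₀ hp] at hx2; linarith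
    obtain ⟨i1, i2⟩ := int_calc (C := chebyshevPsi x + 1) (a := (1 - ε) * x) (by positivity) hxx
    have hm := intervalIntegral.integral_mono_on hxx (psiA_ii hx3 hx1) i1 (fun v hv => by
      have := cpsi_mono hv.2
      have h2 := Int.lt_floor_add_one v
      have : 0 < v := by linarith [hv.1]
      gcongr ?_ / _
      linarith)
    rw [i2, Real.log_mul (by positivity) (by positivity)] at hm
    rw [intervalIntegral.integral_symm] at hx
    have hl := Real.log_le_sub_one_of_pos hp
    have e : (chebyshevPsi x + 1) * (1 / ((1 - ε) * x) - 1 / x) = (chebyshevPsi x + 1) / x * (ε / (1 - ε)) := by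
      field_simp; ring
    rw [e] at hm
    have h3 : ε * (1 - ε) ≤ (chebyshevPsi x + 1) / x * (ε / (1 - ε)) := by nlinarith
    rw [← div_le_iff₀ (by positivity)] at h3
    refine le_trans (le_of_eq ?_) h3
    field_simp
  refine tendsto_order.2 ⟨fun a ha => ?_, fun b hb => ?_⟩
  · have e1 : min (1/2) ((1 - a) / 4) ≤ 1/2 := min_le_left _ _
    have e2 : min (1/2) ((1 - a) / 4) ≤ (1 - a) / 4 := min_le_right _ _
    have e3 : 0 < min (1/2) ((1 - a) / 4) := lt_min (by norm_num) (by linarith)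
    filter_upwards [low _ e3 (by linarith), tendsto_inv_atTop_zero.eventually_lt_const (show 0 < (1 - a) / 2 by linarith)] with x h1 h2
    rw [add_div, one_div x] at h1
    nlinarith
  · have e1 : min 1 ((b - 1) / 4) ≤ 1 := min_le_left _ _
    have e2 : min 1 ((b - 1) / 4) ≤ (b - 1) / 4 := min_le_right _ _
    have e3 : 0 < min 1 ((b - 1) / 4) := lt_min (by norm_num) (by linarith)
    filter_upwards [up _ e3] with x h1
    nlinarith

theorem series_conv {c : ℝ} (hI : Tendsto (fun T : ℝ => ∫ v in (1 : ℝ)..T, (chebyshevPsi v - (⌊v⌋ : ℝ)) / v ^ 2) atTop (nhds c)) :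
    Tendsto (fun N : ℕ => ∑ n ∈ Finset.Icc 1 N, (ArithmeticFunction.vonMangoldt n - 1) / (n : ℝ)) atTop (nhds c) := by
  have h1 := ((pnt hI).comp tendsto_natCast_atTop_atTop).sub_const 1
  rw [sub_self] at h1
  have h2 := h1.add (hI.comp tendsto_natCast_atTop_atTop)
  rw [zero_add] at h2
  refine h2.congr' ?_
  filter_upwards [eventually_ge_atTop 1] with N hN
  have hN1 : (1:ℝ) ≤ N := by exact_mod_cast hN
  let d : ℕ → ℝ := fun n => if n = 0 then 0 else ArithmeticFunction.vonMangoldt n - 1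
  have hd : ∀ (m : ℕ) (w : ℕ → ℝ), ∑ k ∈ Finset.Icc 0 m, w k * d k = ∑ k ∈ Finset.Icc 1 m, w k * (ArithmeticFunction.vonMangoldt k - 1) := by
    intro m w
    rw [← Finset.add_sum_Ioc_eq_sum_Icc (Nat.zero_le m)]
    simp only [d, if_true, mul_zero, zero_add]
    refine Finset.sum_congr rfl fun k hk => ?_
    have : k ≠ 0 := by have := (Finset.mem_Ioc.1 hk).1; omega
    simp [this]
  have hd1 : ∀ m : ℕ, ∑ k ∈ Finset.Icc 0 m, d k = ∑ k ∈ Finset.Icc 1 m, (ArithmeticFunction.vonMangoldt k - 1) := by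
    intro m
    simpa using hd m (fun _ => 1)
  have hder : ∀ t : ℝ, deriv (fun x : ℝ => x⁻¹) t = -(t ^ 2)⁻¹ := fun t => by simp
  have h := sum_mul_eq_sub_integral_mul₀' (f := fun x : ℝ => x⁻¹) d (by simp [d]) N
    (fun t ht => differentiableAt_inv (by linarith [ht.1])) (by
      rw [show deriv (fun x : ℝ => x⁻¹) = fun t => -(t ^ 2)⁻¹ from funext hder]
      refine ContinuousOn.integrableOn_Icc ?_
      refine ContinuousOn.neg (ContinuousOn.inv₀ (by fun_prop) fun x hx => ?_)
      have : 0 < x := by linarith [hx.1]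
      positivity)
  rw [hd N (fun k => (k:ℝ)⁻¹), hd1] at h
  have hA := psiA_sum (v := N) (by positivity)
  rw [Nat.floor_natCast, Int.floor_natCast] at hA
  rw [hA] at h
  have e1 : ∫ t in Set.Ioc (1:ℝ) N, deriv (fun x : ℝ => x⁻¹) t * ∑ k ∈ Finset.Icc 0 ⌊t⌋₊, d k = - ∫ v in (1 : ℝ)..N, (chebyshevPsi v - (⌊v⌋ : ℝ)) / v ^ 2 := by
    rw [intervalIntegral.integral_of_le hN1, ← integral_neg]
    refine setIntegral_congr_fun measurableSet_Ioc fun t ht => ?_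
    beta_reduce
    rw [hder, hd1, psiA_sum (by linarith [ht.1])]
    ring
  rw [e1] at h
  have e2 : ∑ n ∈ Finset.Icc 1 N, (ArithmeticFunction.vonMangoldt n - 1) / (n : ℝ) = ∑ n ∈ Finset.Icc 1 N, (n : ℝ)⁻¹ * (ArithmeticFunction.vonMangoldt n - 1) :=
    Finset.sum_congr rfl fun k _ => by ring
  rw [e2, h]
  simp only [Function.comp, Int.cast_natCast]
  have : (N:ℝ) ≠ 0 := by positivity
  field_simp
  ring

/-- The improper integral `∫₁^{∞-} (ψ(v) - ⌊v⌋)/v² dv` converges, with value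
`g(0)` given by the analytic continuation at `0` of
`g(z) = (1/(z+1))(-ζ'(z+1)/ζ(z+1) - ζ(z+1))`; equivalently
`Σ_{n≥1} (Λ(n)-1)/n` converges. -/
theorem stmt_13 :
    (∀ (U : Set ℂ) (G : ℂ → ℂ), IsOpen U → (0 : ℂ) ∈ U →
      DifferentiableOn ℂ G (U ∪ {z : ℂ | 0 < z.re}) →
      (∀ z : ℂ, 0 < z.re →
        G z = (1 / (z + 1)) *
          (-(deriv riemannZeta (z + 1)) / riemannZeta (z + 1) - riemannZeta (z + 1))) →
      Tendsto (fun T : ℝ => ∫ v in (1 : ℝ)..T, (chebyshevPsi v - (⌊v⌋ : ℝ)) / v ^ 2)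
        atTop (nhds (G 0).re)) ∧
    ∃ S : ℝ, Tendsto
      (fun N : ℕ => ∑ n ∈ Finset.Icc 1 N, (ArithmeticFunction.vonMangoldt n - 1) / (n : ℝ))
      atTop (nhds S) := by
  obtain ⟨c, ⟨H, hH, hHc⟩, hI⟩ := int_conv
  refine ⟨fun U G hU h0 hG hGe => ?_, c.re, series_conv hI⟩
  have hG0 : ContinuousAt G 0 :=
    (hG.differentiableAt (mem_of_superset (hU.mem_nhds h0) subset_union_left)).continuousAt
  have hx : Tendsto (fun x : ℝ => (x : ℂ)) (nhdsWithin 0 (Set.Ioi 0)) (nhds 0) := by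
    have := Complex.continuous_ofReal.tendsto 0
    rw [Complex.ofReal_zero] at this
    exact this.mono_left nhdsWithin_le_nhds
  have t1 := hG0.tendsto.comp hx
  have t2 : Tendsto (fun x : ℝ => (x : ℂ) * H x + c) (nhdsWithin 0 (Set.Ioi 0)) (nhds (0 * H 0 + c)) := by
    refine (hx.mul ((hH 0 (by simp)).tendsto.comp (tendsto_nhdsWithin_iff.2 ⟨hx, ?_⟩))).add_const c
    filter_upwards [self_mem_nhdsWithin] with x hx
    simpa using le_of_lt hx
  have : G 0 = c := by
    rw [zero_mul, zero_add] at t2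
    refine tendsto_nhds_unique t1 (t2.congr' ?_)
    filter_upwards [self_mem_nhdsWithin] with x hx
    have hx' : 0 < (x : ℂ).re := by simpa using hx
    simp only [Function.comp]
    rw [hGe _ hx', hHc _ hx']
  rw [this]
  exact hI
end

section
/- Let g(z) = Σ_{n=0}^∞ a_n z^n be analytic in the unit disc with an analytic continuation to a neighborhood of the point z = 1, and suppose a_n → 0 as n → ∞. Then Σ_{n=0}^∞ a_n converges to g(1) (Fatou's theorem). -/
open Complex Filter Metric Finset

lemma fatou_out (b : ℕ → ℝ) (m k : ℕ) (hk : 0 < k) (e M r : ℝ) (he : 0 ≤ e) (hM : 0 ≤ M)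
    (hb0 : ∀ n, 0 ≤ b n) (hb : ∀ n, m ≤ n → b n ≤ e) (hr : 1 < r) :
    (r - 1) * (M + ∑ n ∈ Finset.range (m + k), b n * r ^ n) ≤
      (e + (M + ∑ n ∈ Finset.range m, b n) / k) * r ^ (m + k) := by
  have hA : 0 ≤ ∑ n ∈ Finset.range m, b n := Finset.sum_nonneg fun n _ => hb0 n
  set A := ∑ n ∈ Finset.range m, b n with hAdef
  have hrm : 1 ≤ r ^ m := one_le_pow₀ hr.le
  have hk' : (0 : ℝ) < k := by exact_mod_cast hk
  have hS1 : ∑ n ∈ Finset.range m, b n * r ^ n ≤ A * r ^ m := by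
    rw [hAdef, Finset.sum_mul]
    refine Finset.sum_le_sum fun n hn => ?_
    exact mul_le_mul_of_nonneg_left (pow_le_pow_right₀ hr.le (Finset.mem_range.1 hn).le) (hb0 n)
  have hS2 : ∑ n ∈ Finset.range k, b (m + n) * r ^ (m + n)
      ≤ e * r ^ m * ∑ n ∈ Finset.range k, r ^ n := by
    rw [Finset.mul_sum]
    refine Finset.sum_le_sum fun n hn => ?_
    rw [pow_add, ← mul_assoc]
    have h1 : 0 ≤ r ^ m := by positivity
    have h2 : 0 ≤ r ^ n := by positivity
    have := hb (m + n) (by omega)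
    gcongr
  have hgeo : (∑ n ∈ Finset.range k, r ^ n) * (r - 1) = r ^ k - 1 := geom_sum_mul r k
  have hber : k * (r - 1) ≤ r ^ k := by
    have := one_add_mul_le_pow (a := r - 1) (by linarith) k
    simp only [add_sub_cancel] at this
    linarith
  have hber' : r - 1 ≤ r ^ k / k := by rw [le_div_iff₀ hk']; linarith
  rw [Finset.sum_range_add]
  have hMr : M ≤ M * r ^ m := le_mul_of_one_le_right hM hrm
  have hr1 : 0 ≤ r - 1 := by linarith
  calc (r - 1) * (M + (∑ n ∈ Finset.range m, b n * r ^ n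
        + ∑ n ∈ Finset.range k, b (m + n) * r ^ (m + n)))
      ≤ (r - 1) * (M * r ^ m + (A * r ^ m + e * r ^ m * ∑ n ∈ Finset.range k, r ^ n)) := by
        gcongr
    _ = (r - 1) * ((M + A) * r ^ m) + e * r ^ m * (r ^ k - 1) := by rw [← hgeo]; ring
    _ ≤ (r ^ k / k) * ((M + A) * r ^ m) + e * r ^ m * (r ^ k) := by
        gcongr
        linarith
    _ = _ := by rw [pow_add]; field_simp; ring

lemma fatou_in (a : ℕ → ℂ) (N : ℕ) (e : ℝ) (z w : ℂ) 
    (hz : ‖z‖ < 1) (hw : HasSum (fun n : ℕ => a n * z ^ n) w)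
    (hb : ∀ n, N ≤ n → ‖a n‖ ≤ e) :
    ‖w - ∑ n ∈ Finset.range N, a n * z ^ n‖ * (1 - ‖z‖) ≤ e * ‖z‖ ^ N := by
  have h1 := (hasSum_nat_add_iff' N).2 hw
  have hg : HasSum (fun n : ℕ => e * ‖z‖ ^ N * ‖z‖ ^ n) (e * ‖z‖ ^ N * (1 - ‖z‖)⁻¹) :=
    (hasSum_geometric_of_lt_one (norm_nonneg z) hz).mul_left _
  have h2 := tsum_of_norm_bounded hg (f := fun n => a (n + N) * z ^ (n + N)) (fun n => by
    rw [norm_mul, norm_pow, pow_add, mul_comm (‖z‖ ^ n), ← mul_assoc]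
    have := hb (n + N) (by omega)
    gcongr)
  rw [h1.tsum_eq] at h2
  have : 0 < 1 - ‖z‖ := by linarith
  rwa [← div_eq_mul_inv, le_div_iff₀ this] at h2

lemma fatou_P (ρ : ℝ) (h0 : 0 < ρ) (h2 : ρ ≤ 1 / 2) (z : ℂ) (hz : ‖z - 1‖ = ρ) :
    ‖(z - 1) ^ 2 + ρ ^ 2 * (z - 1) + ρ ^ 2‖ ≤ 3 * |‖z‖ - 1| := by
  have e1 : ((ρ : ℂ)) ^ 2 = (z - 1) * (starRingEnd ℂ) (z - 1) := by
    rw [Complex.mul_conj, Complex.normSq_eq_norm_sq, hz]; push_cast; rfl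
  have e2 : ((‖z‖ : ℂ)) ^ 2 = z * (starRingEnd ℂ) z := by
    rw [Complex.mul_conj, Complex.normSq_eq_norm_sq]; push_cast; rfl
  have e3 : (z - 1) ^ 2 + ρ ^ 2 * (z - 1) + ρ ^ 2
      = (z - 1) * (((‖z‖ - 1) * (‖z‖ + 1) : ℝ) : ℂ) := by
    have : (((‖z‖ - 1) * (‖z‖ + 1) : ℝ) : ℂ) = (‖z‖ : ℂ) ^ 2 - 1 := by push_cast; ring
    rw [this, e1, e2, map_sub, map_one]; ring
  have hn : ‖z‖ ≤ 3 / 2 := by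
    have := norm_add_le (z - 1) 1
    simp only [sub_add_cancel, norm_one] at this
    linarith
  rw [e3, norm_mul, hz, Complex.norm_real, Real.norm_eq_abs, abs_mul,
    abs_of_nonneg (by positivity : 0 ≤ ‖z‖ + 1)]
  have := abs_nonneg (‖z‖ - 1)
  have h5 : ρ * (‖z‖ + 1) ≤ 3 := by nlinarith [norm_nonneg z]
  nlinarith

/-- Fatou's theorem: if `g(z) = Σ aₙ zⁿ` on the unit disc extends analytically
to a neighborhood of `z = 1` and `aₙ → 0`, then `Σ aₙ` converges to `g(1)`
(the value of the continuation at `1`). -/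
theorem stmt_17 (a : ℕ → ℂ) (g G : ℂ → ℂ) (U : Set ℂ)
    (hg : ∀ z ∈ Metric.ball (0 : ℂ) 1, HasSum (fun n : ℕ => a n * z ^ n) (g z))
    (hU : IsOpen U) (h1 : (1 : ℂ) ∈ U)
    (hG : DifferentiableOn ℂ G (U ∪ Metric.ball (0 : ℂ) 1))
    (hagree : ∀ z ∈ Metric.ball (0 : ℂ) 1, G z = g z)
    (ha : Tendsto a atTop (nhds 0)) :
    Tendsto (fun N : ℕ => ∑ n ∈ Finset.range N, a n) atTop (nhds (G 1)) := by
  obtain ⟨δ, hδ, hδU⟩ := Metric.isOpen_iff.1 hU 1 h1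
  obtain ⟨ρ, hρ0, hρ2, hρδ⟩ : ∃ ρ : ℝ, 0 < ρ ∧ ρ ≤ 1 / 2 ∧ ρ < δ :=
    ⟨min (1 / 2) (δ / 2), by positivity, min_le_left _ _, (min_le_right _ _).trans_lt (by linarith)⟩
  have hsub : closedBall (1 : ℂ) ρ ⊆ U := (closedBall_subset_ball hρδ).trans hδU
  have hGd : DifferentiableOn ℂ G (closedBall (1 : ℂ) ρ) :=
    hG.mono (hsub.trans Set.subset_union_left)
  obtain ⟨M, hM⟩ := (isCompact_closedBall (1 : ℂ) ρ).exists_bound_of_continuousOn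
    hGd.continuousOn
  have hM0 : 0 ≤ M := (norm_nonneg _).trans (hM 1 (mem_closedBall_self hρ0.le))
  have hz0 : ∀ z ∈ closedBall (1 : ℂ) ρ, z ≠ 0 := by
    rintro z hz rfl
    rw [mem_closedBall, dist_eq_norm] at hz
    norm_num at hz
    linarith
  have key : ∀ (m k : ℕ) (e : ℝ), 0 < k → 0 ≤ e → (∀ n, m ≤ n → ‖a n‖ ≤ e) →
      ρ ^ 2 * ‖G 1 - ∑ n ∈ Finset.range (m + k), a n‖
        ≤ 3 * (e + (M + ∑ n ∈ Finset.range m, ‖a n‖) / k) := by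
    intro m k e hk he hb
    set B := e + (M + ∑ n ∈ Finset.range m, ‖a n‖) / k with hB
    have hA : 0 ≤ ∑ n ∈ Finset.range m, ‖a n‖ := Finset.sum_nonneg fun n _ => norm_nonneg _
    have hBe : e ≤ B := le_add_of_nonneg_right (by positivity)
    let K : ℂ → ℂ := fun z => (G z - ∑ n ∈ Finset.range (m + k), a n * z ^ n) / z ^ (m + k)
      * ((z - 1) ^ 2 + ρ ^ 2 * (z - 1) + ρ ^ 2)
    have hK : DifferentiableOn ℂ K (closedBall (1 : ℂ) ρ) := by
      refine DifferentiableOn.mul (DifferentiableOn.div (hGd.sub ?_) ?_ ?_) ?_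
      · fun_prop
      · fun_prop
      · intro z hz
        exact pow_ne_zero _ (hz0 z hz)
      · fun_prop
    have hKd : DiffContOnCl ℂ K (ball (1 : ℂ) ρ) :=
      ⟨hK.mono ball_subset_closedBall, by
        rw [closure_ball _ hρ0.ne']; exact hK.continuousOn⟩
    have hbd : ∀ z ∈ frontier (ball (1 : ℂ) ρ), ‖K z‖ ≤ 3 * B := by
      intro z hz
      rw [frontier_ball _ hρ0.ne'] at hz
      have hzc := sphere_subset_closedBall hz
      rw [mem_sphere, dist_eq_norm] at hz
      have hP := fatou_P ρ hρ0 hρ2 z hz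
      have hzp : 0 < ‖z‖ ^ (m + k) := pow_pos (norm_pos_iff.2 (hz0 z hzc)) _
      have main : ‖G z - ∑ n ∈ Finset.range (m + k), a n * z ^ n‖ * |‖z‖ - 1|
          ≤ B * ‖z‖ ^ (m + k) := by
        rcases lt_trichotomy ‖z‖ 1 with h | h | h
        · have hzb : z ∈ ball (0 : ℂ) 1 := by simpa using h
          have := fatou_in a (m + k) e z (g z) h (hg z hzb) (fun n hn => hb n (by omega))
          rw [hagree z hzb, abs_of_neg (by linarith), neg_sub]
          exact this.trans (by gcongr)
        · rw [h]; simp; positivity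
        · have := fatou_out (fun n => ‖a n‖) m k hk e M ‖z‖ he hM0 (fun n => norm_nonneg _) hb h
          rw [abs_of_pos (by linarith), mul_comm]
          refine le_trans ?_ this
          have h3 : 0 ≤ ‖z‖ - 1 := by linarith
          refine mul_le_mul_of_nonneg_left ?_ h3
          refine (norm_sub_le _ _).trans (add_le_add (hM z hzc) ?_)
          refine (norm_sum_le _ _).trans (le_of_eq ?_)
          simp
      simp only [K]
      rw [norm_mul, norm_div, norm_pow, div_mul_eq_mul_div, div_le_iff₀ hzp]
      refine (mul_le_mul_of_nonneg_left hP (norm_nonneg _)).trans ?_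
      linarith
    have := Complex.norm_le_of_forall_mem_frontier_norm_le isBounded_ball hKd hbd
      (subset_closure (mem_ball_self hρ0))
    simp only [K] at this
    simp only [one_pow, mul_one, div_one, sub_self] at this
    rw [norm_mul, mul_comm] at this
    simpa [abs_of_pos hρ0] using this
  rw [Metric.tendsto_atTop]
  intro η hη
  have hη' : 0 < ρ ^ 2 * η / 12 := by positivity
  obtain ⟨m, hm⟩ := Metric.tendsto_atTop.1 ha _ hη'
  obtain ⟨k₀, hk₀⟩ := exists_nat_gt ((M + ∑ n ∈ Finset.range m, ‖a n‖) / (ρ ^ 2 * η / 12))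
  refine ⟨m + (k₀ + 1), fun N hN => ?_⟩
  obtain ⟨k, rfl⟩ := Nat.exists_eq_add_of_le (show m ≤ N by omega)
  have hk : 0 < k := by omega
  have hkk : (k₀ : ℝ) ≤ k := by exact_mod_cast (by omega : k₀ ≤ k)
  have h := key m k _ hk hη'.le (fun n hn => by
    have := hm n hn
    rw [dist_zero_right] at this
    exact this.le)
  have hk' : (0 : ℝ) < k := by exact_mod_cast hk
  have h4 : (M + ∑ n ∈ Finset.range m, ‖a n‖) / k ≤ ρ ^ 2 * η / 12 := by
    rw [div_lt_iff₀ hη'] at hk₀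
    rw [div_le_iff₀ hk']
    nlinarith
  rw [dist_comm, dist_eq_norm]
  have hρρ : 0 < ρ ^ 2 := by positivity
  refine lt_of_mul_lt_mul_left ?_ hρρ.le
  have : 0 < ρ ^ 2 * η := by positivity
  linarith
end
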